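/- arXiv:1208.3568 — 2 statements merged into one kernel-verified Lean document; each statement's English description precedes it below -/
import Mathlib

section
/- There is an absolute constant C > 0 such that for all δ > 0 and every integer t ≥ 3 there exists m₀ = m₀(δ,t) with the following property: let G be a δ-expander on m ≥ m₀ vertices and set γ = δ/(5·(log log m)²); if G contains t pairwise disjoint vertex sets S_1,…,S_t such that each induced subgraph G[S_i] is a γ-expanding ball, m^{1/5} ≤ |S_i| ≤ m^{1/4}, and every vertex of G[S_i] has degree at most (log m)⁴ in G[S_i], then G contains a K_t-minor of order at most C·(t²/δ)·log m·(log log m)³. -/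
open Real

/-- Edge density `d(G) = |E(G)|/|V(G)|`. -/
noncomputable def density {V : Type*} (G : SimpleGraph V) : ℝ :=
  G.edgeSet.ncard / Nat.card V

/-- External neighborhood `N(S)`: vertices outside `S` adjacent to some vertex of `S`. -/
def nbhd {V : Type*} (G : SimpleGraph V) (S : Set V) : Set V :=
  {v | v ∉ S ∧ ∃ u ∈ S, G.Adj u v}

/-- `G` contains a `K_t`-minor (branch sets are disjoint, nonempty, connected,
pairwise joined by an edge). -/
def HasKtMinor {V : Type*} (G : SimpleGraph V) (t : ℕ) : Prop :=
  ∃ P : Fin t → Set V,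
    (∀ i, (P i).Nonempty) ∧
    (Pairwise (Function.onFun Disjoint P)) ∧
    (∀ i, (G.induce (P i)).Connected) ∧
    (∀ i j : Fin t, i < j → ∃ u ∈ P i, ∃ v ∈ P j, G.Adj u v)

/-- `G` contains a `K_t`-minor of order at most `k`. -/
def HasKtMinorOfOrder {V : Type*} (G : SimpleGraph V) (t : ℕ) (k : ℝ) : Prop :=
  ∃ P : Fin t → Set V,
    (∀ i, (P i).Nonempty) ∧
    (Pairwise (Function.onFun Disjoint P)) ∧
    (∀ i, (G.induce (P i)).Connected) ∧
    (∀ i j : Fin t, i < j → ∃ u ∈ P i, ∃ v ∈ P j, G.Adj u v) ∧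
    ((⋃ i, P i).ncard : ℝ) ≤ k

/-- `c(t)`: the least `c` such that every graph of density at least `c` has a `K_t`-minor. -/
noncomputable def minorThreshold (t : ℕ) : ℝ :=
  sInf {c : ℝ | ∀ (n : ℕ) (G : SimpleGraph (Fin n)), density G ≥ c → HasKtMinor G t}

/-- `δ`-expander. -/
def IsDeltaExpander {V : Type*} (G : SimpleGraph V) (δ : ℝ) : Prop :=
  ∀ d : ℕ, (d : ℝ) ≤ logb 2 (logb 2 (Nat.card V)) - 1 →
    ∀ S : Set V, (S.ncard : ℝ) ≤ (Nat.card V : ℝ) / (2 : ℝ) ^ (2 ^ d : ℕ) →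
      ((nbhd G S).ncard : ℝ) ≥
        δ * 2 ^ d / (logb 2 (Nat.card V) * (logb 2 (logb 2 (Nat.card V))) ^ 2) * S.ncard

/-- `(δ, n)`-expander. -/
def IsDeltaNExpander {V : Type*} (G : SimpleGraph V) (δ : ℝ) (n : ℕ) : Prop :=
  ∀ d : ℕ, (d : ℝ) ≤ logb 2 (logb 2 (Nat.card V)) - 1 →
    ∀ S : Set V, (S.ncard : ℝ) ≤ (Nat.card V : ℝ) / (2 : ℝ) ^ (2 ^ d : ℕ) →
      ((nbhd G S).ncard : ℝ) ≥ δ * 2 ^ d / logb 2 n * S.ncard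

/-- `B_k(v)`: ball of radius `k` around the vertex `v`. -/
def gball {V : Type*} (G : SimpleGraph V) (v : V) (k : ℕ) : Set V :=
  {u | ∃ p : G.Walk v u, p.length ≤ k}

/-- `B_k(U)`: ball of radius `k` around the vertex set `U`. -/
def gballSet {V : Type*} (G : SimpleGraph V) (U : Set V) (k : ℕ) : Set V :=
  {v | ∃ u ∈ U, ∃ p : G.Walk u v, p.length ≤ k}

/-- A graph `H` is a `γ`-expanding ball: it is covered by a ball `B_k(v)` all of whose
intermediate balls expand by a factor `1 + γ`. -/
def GraphIsExpandingBall {V : Type*} (H : SimpleGraph V) (γ : ℝ) : Prop :=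
  ∃ (v : V) (k : ℕ), gball H v k = Set.univ ∧
    ∀ i : ℕ, 1 ≤ i → i + 1 ≤ k →
      ((gball H v (i + 1)).ncard : ℝ) ≥ (1 + γ) * (gball H v i).ncard

/-- Following a walk into `B` until just before it first meets `B` gives a connected set. -/
theorem exists_connected_prefix {V : Type*} {G : SimpleGraph V} {B : Set V} {a b : V}
    (p : G.Walk a b) (ha : a ∉ B) (hb : b ∈ B) :
    ∃ R : Set V, a ∈ R ∧ (∀ x ∈ R, x ∈ p.support) ∧ Disjoint R B ∧
      (G.induce R).Connected ∧ R.ncard ≤ p.length ∧ ∃ x ∈ R, ∃ y ∈ B, G.Adj x y := by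
  induction p with
  | nil => exact absurd hb ha
  | @cons u w z h p ih =>
    by_cases hw : w ∈ B
    · refine ⟨{u}, rfl, by simp, by simpa using ha, by simp, by simp, u, rfl, w, hw, h⟩
    · obtain ⟨R, hwR, hsupp, hdisj, hconn, hcard, x, hx, y, hy, hxy⟩ := ih hw hb
      refine ⟨{u} ∪ R, by simp, ?_, ?_, ?_, ?_, x, Or.inr hx, y, hy, hxy⟩
      · rintro z (rfl | hz)
        · simp
        · simp [hsupp z hz]
      · rw [Set.disjoint_union_left]
        exact ⟨by simpa using ha, hdisj⟩
      · exact SimpleGraph.connected_induce_union (v := u) (w := w) (by simp)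
          hconn.preconnected rfl hwR h
      · refine (Set.ncard_union_le _ _).trans ?_
        simp only [Set.ncard_singleton, SimpleGraph.Walk.length_cons]
        omega

theorem ncard_support_le {V : Type*} {G : SimpleGraph V} {a b : V} (p : G.Walk a b) :
    {x | x ∈ p.support}.ncard ≤ p.length + 1 := by
  classical
  rw [← p.length_support, ← List.coe_toFinset, Set.ncard_coe_finset]
  exact p.support.toFinset_card_le

/-- A connected set containing the root of `X` reaches any vertex of `P ∪ X` after absorbing
a short route inside `X`. -/
theorem exists_route_to {V : Type*} {G : SimpleGraph V} {P X : Set V} {v a : V} {q : ℕ}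
    (hv : v ∈ P) (hP : (G.induce P).Connected)
    (hroute : ∀ x ∈ X, ∃ p : G.Walk v x, p.length ≤ q ∧ ∀ y ∈ p.support, y ∈ X)
    (ha : a ∈ P ∪ X) :
    ∃ E ⊆ X, E.ncard ≤ q + 1 ∧ (G.induce (P ∪ E)).Connected ∧ a ∈ P ∪ E := by
  rcases ha with ha | ha
  · exact ⟨∅, by simp, by simp, by rwa [Set.union_empty], Or.inl ha⟩
  · obtain ⟨p, hpq, hpX⟩ := hroute a ha
    refine ⟨{x | x ∈ p.support}, hpX, (ncard_support_le p).trans (by omega), ?_, Or.inr (by simp)⟩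
    exact SimpleGraph.induce_union_connected hP.preconnected
      p.connected_induce_support.preconnected ⟨v, hv, by simp⟩

/-- Given nested families of rooted sets such that sets at one level can always be linked by short
walks avoiding few vertices and all other sets at the level below, any list of pairs of
branch sets can be successively made adjacent. -/
theorem exists_linked_branch_sets {V : Type*} [Finite V] {G : SimpleGraph V} {t T q Q N : ℕ}
    {X : Fin t → ℕ → Set V} {v : Fin t → V}
    (hdisj : ∀ i j, i ≠ j → ∀ r, Disjoint (X i r) (X j r))
    (hmono : ∀ i r, X i r ⊆ X i (r + 1))
    (hroute : ∀ i r, ∀ x ∈ X i r,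
      ∃ p : G.Walk (v i) x, p.length ≤ q ∧ ∀ y ∈ p.support, y ∈ X i r)
    (hlink : ∀ r < T, ∀ i j, ∀ W A B : Set V, X i (r + 1) ⊆ A → X j (r + 1) ⊆ B →
      Disjoint A W → Disjoint B W → W.ncard ≤ ∑ k, (X k r).ncard + N →
      ∃ a ∈ A, ∃ b ∈ B, ∃ p : G.Walk a b, p.length ≤ Q ∧ ∀ x ∈ p.support, x ∉ W)
    (l : List (Fin t × Fin t)) (hl : l.length ≤ T) (hne : ∀ e ∈ l, e.1 ≠ e.2)
    (P : Fin t → Set V) (hv : ∀ i, v i ∈ P i) (hPdisj : ∀ i j, i ≠ j → Disjoint (P i) (P j))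
    (hP : ∀ i, (G.induce (P i)).Connected)
    (hPX : ∀ i j, i ≠ j → Disjoint (P i) (X j l.length))
    (hN : (⋃ i, P i).ncard + l.length * (Q + 2 * q + 2) ≤ N) :
    ∃ P' : Fin t → Set V, (∀ i, P i ⊆ P' i) ∧ (∀ i j, i ≠ j → Disjoint (P' i) (P' j)) ∧
      (∀ i, (G.induce (P' i)).Connected) ∧
      (∀ e ∈ l, ∃ x ∈ P' e.1, ∃ y ∈ P' e.2, G.Adj x y) ∧
      (⋃ i, P' i).ncard ≤ (⋃ i, P i).ncard + l.length * (Q + 2 * q + 2) := by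
  induction l generalizing P with
  | nil => exact ⟨P, fun _ => subset_rfl, hPdisj, hP, by simp, by simp⟩
  | cons e l ih =>
    obtain ⟨i, j⟩ := e
    have hij : i ≠ j := hne (i, j) (by simp)
    set r := l.length with hr
    simp only [List.length_cons, ← hr] at hl hPX hN ⊢
    set W : Set V := (⋃ k ∈ {k | k ≠ i ∧ k ≠ j}, X k r) ∪ ⋃ k ∈ {k | k ≠ i ∧ k ≠ j}, P k with hW
    have hWX : ∀ k, k ≠ i → k ≠ j → ∀ x ∈ X k r, x ∈ W := fun k hi hj x hx =>
      Or.inl (Set.mem_biUnion (show k ∈ {k | k ≠ i ∧ k ≠ j} from ⟨hi, hj⟩) hx)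
    have hWP : ∀ k, k ≠ i → k ≠ j → ∀ x ∈ P k, x ∈ W := fun k hi hj x hx =>
      Or.inr (Set.mem_biUnion (show k ∈ {k | k ≠ i ∧ k ≠ j} from ⟨hi, hj⟩) hx)
    have hAW : ∀ c, (c = i ∨ c = j) → Disjoint (P c ∪ X c (r + 1)) W := by
      intro c hc
      have key : ∀ k, k ≠ i ∧ k ≠ j → c ≠ k := by
        rintro k ⟨h1, h2⟩ rfl
        rcases hc with h | h
        · exact h1 h
        · exact h2 h
      rw [hW]
      simp only [Set.disjoint_union_left, Set.disjoint_union_right, Set.disjoint_iUnion₂_right,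
        Set.mem_ofPred_eq]
      exact ⟨fun k hk => ⟨(hPX c k (key k hk)).mono_right (hmono k r),
          (hdisj c k (key k hk) (r + 1)).mono_right (hmono k r)⟩,
        fun k hk => ⟨hPdisj c k (key k hk), (hPX k c (key k hk).symm).symm⟩⟩
    have hAB : Disjoint (P i ∪ X i (r + 1)) (P j ∪ X j (r + 1)) := by
      simp only [Set.disjoint_union_left, Set.disjoint_union_right]
      exact ⟨⟨hPdisj i j hij, (hPX j i hij.symm).symm⟩, hPX i j hij, hdisj i j hij _⟩
    have hWcard : W.ncard ≤ ∑ k, (X k r).ncard + N := by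
      refine (Set.ncard_union_le _ _).trans (add_le_add ?_ ?_)
      · refine (Set.ncard_le_ncard (t := ⋃ k ∈ (Finset.univ : Finset (Fin t)), X k r)
          ?_ (Set.toFinite _)).trans (Finset.set_ncard_biUnion_le _ _)
        exact Set.iUnion₂_subset fun k _ => Set.subset_biUnion_of_mem (u := fun k => X k r)
          (Finset.mem_univ k)
      · refine le_trans (Set.ncard_le_ncard (t := ⋃ k, P k) ?_ (Set.toFinite _)) (by omega)
        exact Set.iUnion₂_subset fun k _ => Set.subset_iUnion P k
    obtain ⟨a, ha, b, hb, p, hpQ, hpW⟩ := hlink r (by omega) i j W _ _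
      Set.subset_union_right Set.subset_union_right (hAW i (Or.inl rfl)) (hAW j (Or.inr rfl)) hWcard
    obtain ⟨R, haR, hRp, hRB, hRconn, hRcard, x, hxR, y, hyB, hxy⟩ :=
      exists_connected_prefix p (Set.disjoint_left.1 hAB ha) hb
    obtain ⟨E, hEX, hEcard, hEconn, haE⟩ := exists_route_to (hv i) (hP i) (hroute i (r + 1)) ha
    obtain ⟨F, hFX, hFcard, hFconn, hyF⟩ := exists_route_to (hv j) (hP j) (hroute j (r + 1)) hyB
    have hRW : ∀ x ∈ R, x ∉ W := fun x hx => hpW x (hRp x hx)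
    set D : Fin t → Set V := fun k => if k = i then E ∪ R else if k = j then F else ∅ with hD
    have hDi : D i = E ∪ R := by simp [hD]
    have hDj : D j = F := by simp [hD, hij.symm]
    have hDk : ∀ k, k ≠ i → k ≠ j → D k = ∅ := fun k h1 h2 => by simp [hD, h1, h2]
    have hDP : ∀ k c, k ≠ c → Disjoint (D k) (P c) := by
      intro k c hkc
      by_cases h1 : k = i
      · subst h1
        rw [hDi, Set.disjoint_union_left]
        refine ⟨((hPX c k hkc.symm).mono_right hEX).symm, ?_⟩
        by_cases h2 : c = j
        · subst h2; exact hRB.mono_right Set.subset_union_left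
        · exact Set.disjoint_left.2 fun x hx hx' => hRW x hx (hWP c hkc.symm h2 x hx')
      · by_cases h2 : k = j
        · subst h2; rw [hDj]; exact ((hPX c k hkc.symm).mono_right hFX).symm
        · rw [hDk k h1 h2]; exact Set.empty_disjoint _
    have hDX : ∀ k c, k ≠ c → Disjoint (D k) (X c r) := by
      intro k c hkc
      have hX := (hdisj k c hkc (r + 1)).mono_right (hmono c r)
      by_cases h1 : k = i
      · subst h1
        rw [hDi, Set.disjoint_union_left]
        refine ⟨hX.mono_left hEX, ?_⟩
        by_cases h2 : c = j
        · subst h2; exact hRB.mono_right ((hmono _ _).trans Set.subset_union_right)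
        · exact Set.disjoint_left.2 fun x hx hx' => hRW x hx (hWX c hkc.symm h2 x hx')
      · by_cases h2 : k = j
        · subst h2; rw [hDj]; exact hX.mono_left hFX
        · rw [hDk k h1 h2]; exact Set.empty_disjoint _
    have hDij : Disjoint (D i) (D j) := by
      rw [hDi, hDj, Set.disjoint_union_left]
      exact ⟨(hdisj i j hij (r + 1)).mono hEX hFX,
        hRB.mono_right (hFX.trans Set.subset_union_right)⟩
    have hDD : ∀ k c, k ≠ c → Disjoint (D k) (D c) := by
      intro k c hkc
      rcases em (k = i) with rfl | h1
      · rcases em (c = j) with rfl | h2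
        · exact hDij
        · rw [hDk c hkc.symm h2]; exact Set.disjoint_empty _
      · rcases em (k = j) with rfl | h2
        · rcases em (c = i) with rfl | h3
          · exact hDij.symm
          · rw [hDk c h3 hkc.symm]; exact Set.disjoint_empty _
        · rw [hDk k h1 h2]; exact Set.empty_disjoint _
    have hconn : ∀ k, (G.induce (P k ∪ D k)).Connected := by
      intro k
      by_cases h1 : k = i
      · subst h1
        rw [hDi, ← Set.union_assoc]
        exact SimpleGraph.induce_union_connected hEconn.preconnected hRconn.preconnected
          ⟨a, haE, haR⟩
      · by_cases h2 : k = j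
        · subst h2; rw [hDj]; exact hFconn
        · rw [hDk k h1 h2, Set.union_empty]; exact hP k
    have hcard : (⋃ k, P k ∪ D k).ncard ≤ (⋃ k, P k).ncard + (Q + 2 * q + 2) := by
      have hsub : (⋃ k, P k ∪ D k) ⊆ (⋃ k, P k) ∪ ((E ∪ R) ∪ F) := by
        refine Set.iUnion_subset fun k => Set.union_subset_union (Set.subset_iUnion P k) ?_
        by_cases h1 : k = i
        · subst h1; rw [hDi]; exact Set.subset_union_left
        · by_cases h2 : k = j
          · subst h2; rw [hDj]; exact Set.subset_union_right
          · rw [hDk k h1 h2]; exact Set.empty_subset _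
      have h1 := Set.ncard_le_ncard hsub (Set.toFinite _)
      have h2 := Set.ncard_union_le (⋃ k, P k) ((E ∪ R) ∪ F)
      have h3 := Set.ncard_union_le (E ∪ R) F
      have h4 := Set.ncard_union_le E R
      omega
    obtain ⟨P', hPP', hdisj', hconn', hadj', hcard'⟩ := ih (by omega)
      (fun e he => hne e (List.mem_cons_of_mem _ he)) (fun k => P k ∪ D k)
      (fun k => Or.inl (hv k))
      (fun k c hkc => by
        simp only [Set.disjoint_union_left, Set.disjoint_union_right]
        exact ⟨⟨hPdisj k c hkc, hDP k c hkc⟩, (hDP c k hkc.symm).symm, hDD k c hkc⟩)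
      hconn
      (fun k c hkc => by
        simp only [Set.disjoint_union_left]
        exact ⟨(hPX k c hkc).mono_right (hmono c r), hDX k c hkc⟩)
      (by
        refine le_trans (Nat.add_le_add_right hcard _) ?_
        linarith)
    refine ⟨P', fun k => Set.subset_union_left.trans (hPP' k), hdisj', hconn', ?_, ?_⟩
    · intro e he
      rcases List.mem_cons.1 he with rfl | he
      · refine ⟨x, hPP' i (Or.inr ?_), y, hPP' j ?_, hxy⟩
        · rw [hDi]; exact Or.inr hxR
        · rw [hDj]; exact hyF
      · exact hadj' e he
    · linarith

theorem half_le_logb_two_one_add {x : ℝ} (h0 : 0 ≤ x) (h1 : x ≤ 1) :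
    x / 2 ≤ logb 2 (1 + x) := by
  have hlog2 : Real.log 2 ≤ 1 := by linarith [Real.log_two_lt_d9]
  have hlog2' : 0 < Real.log 2 := Real.log_pos (by norm_num)
  have hlog : x / 2 ≤ Real.log (1 + x) := by
    refine le_trans ?_ (Real.le_log_one_add_of_nonneg h0)
    rw [div_le_div_iff₀ (by norm_num) (by linarith)]
    nlinarith
  rw [logb, le_div_iff₀ hlog2']
  nlinarith

theorem exists_two_pow_near {y L : ℝ} (hy : 1 ≤ y) (hyL : y ≤ L) (hL : 2 ≤ L) :
    ∃ d : ℕ, (2 : ℝ) ^ d ≤ y ∧ (2 : ℝ) ^ d ≤ L / 2 ∧ y ≤ 4 * 2 ^ d := by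
  rcases lt_or_ge y 2 with h | h
  · exact ⟨0, by simpa using hy, by norm_num; linarith, by norm_num; linarith⟩
  · obtain ⟨n, hn, hn'⟩ := exists_nat_pow_near (x := y / 2) (by linarith)
      (one_lt_two : (1 : ℝ) < 2)
    rw [pow_succ] at hn'
    exact ⟨n, by linarith, by linarith, by linarith⟩

/-- One step of expansion away from a small forbidden set `W` shrinks `log (m / |S|)` by a
constant factor. -/
theorem IsDeltaExpander.logb_card_div_le {V : Type*} [Finite V] {G : SimpleGraph V} {δ L ℓ : ℝ}
    (hG : IsDeltaExpander G δ) (hδ : 0 < δ) (hL : logb 2 (Nat.card V) = L) (hℓ : logb 2 L = ℓ)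
    (hL2 : 2 ≤ L) (hℓ1 : 1 ≤ ℓ) (hδℓ : δ ≤ ℓ ^ 2) {S S' W : Set V} (hS : S.Nonempty)
    (hScard : (S.ncard : ℝ) ≤ (Nat.card V : ℝ) / 2) (hSS' : S ⊆ S')
    (hNS' : nbhd G S \ W ⊆ S') (hW : 2 * L * ℓ ^ 2 * W.ncard ≤ δ * S.ncard) :
    logb 2 ((Nat.card V : ℝ) / S'.ncard) ≤
      (1 - δ / (16 * L * ℓ ^ 2)) * logb 2 ((Nat.card V : ℝ) / S.ncard) := by
  have hx1 : (1 : ℝ) ≤ S.ncard := by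
    exact_mod_cast Nat.succ_le_of_lt ((Set.ncard_pos (Set.toFinite S)).2 hS)
  set x := (S.ncard : ℝ) with hx
  set m := (Nat.card V : ℝ) with hm
  have hx0 : 0 < x := by linarith
  have hm0 : 0 < m := by linarith
  set y := logb 2 (m / x) with hy
  have hy1 : 1 ≤ y := by
    rw [hy, Real.le_logb_iff_rpow_le (by norm_num) (by positivity), Real.rpow_one,
      le_div_iff₀ hx0]
    linarith
  have hyL : y ≤ L := by
    rw [hy, ← hL]
    exact Real.logb_le_logb_of_le (by norm_num) (by positivity) (div_le_self hm0.le hx1)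
  obtain ⟨d, hd1, hd2, hd3⟩ := exists_two_pow_near hy1 hyL hL2
  have hdℓ : (d : ℝ) ≤ ℓ - 1 := by
    have : logb 2 (L / 2) = ℓ - 1 := by
      rw [Real.logb_div (by linarith) (by norm_num), hℓ, Real.logb_self_eq_one (by norm_num)]
    rw [← this, Real.le_logb_iff_rpow_le (by norm_num) (by linarith), Real.rpow_natCast]
    exact hd2
  have hxd : x ≤ m / (2 : ℝ) ^ (2 ^ d : ℕ) := by
    rw [le_div_comm₀ hx0 (by positivity)]
    have h1 : ((2 ^ d : ℕ) : ℝ) ≤ y := by push_cast; exact hd1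
    rw [hy, Real.le_logb_iff_rpow_le (by norm_num) (by positivity), Real.rpow_natCast] at h1
    exact h1
  have hexp := hG d (by rw [← hm, hL, hℓ]; exact hdℓ) S hxd
  rw [← hm, hL, hℓ, ← hx] at hexp
  set ε := δ * 2 ^ d / (L * ℓ ^ 2) with hε
  have hLℓ : 0 < L * ℓ ^ 2 := by positivity
  have hε0 : 0 < ε := by positivity
  have hε1 : ε / 2 ≤ 1 := by
    have : ε ≤ 1 := by
      rw [hε, div_le_one hLℓ]
      have h2 : (2 : ℝ) ^ d ≤ L := by linarith
      calc δ * 2 ^ d ≤ ℓ ^ 2 * L := by gcongr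
        _ = L * ℓ ^ 2 := mul_comm _ _
    linarith
  have hWε : (W.ncard : ℝ) ≤ ε / 2 * x := by
    have h1 : (1 : ℝ) ≤ 2 ^ d := one_le_pow₀ (by norm_num)
    have h2 : δ * x ≤ δ * 2 ^ d * x := by
      have : 0 < δ * x := by positivity
      nlinarith
    rw [hε, div_div, div_mul_eq_mul_div, le_div_iff₀ (by positivity)]
    linarith
  have hS'card : x * (1 + ε / 2) ≤ S'.ncard := by
    have hdisj : Disjoint S (nbhd G S \ W) :=
      Set.disjoint_left.2 fun z hz hz' => hz'.1.1 hz
    have h1 := Set.ncard_le_ncard (Set.union_subset hSS' hNS') (Set.toFinite _)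
    rw [Set.ncard_union_eq hdisj (Set.toFinite _) (Set.toFinite _)] at h1
    have h2 := Set.le_ncard_sdiff W (nbhd G S) (Set.toFinite _)
    have h3 : (S.ncard : ℝ) + (nbhd G S).ncard ≤ S'.ncard + W.ncard := by
      exact_mod_cast (by omega : S.ncard + (nbhd G S).ncard ≤ S'.ncard + W.ncard)
    rw [← hx] at h3
    linarith
  have hlog : logb 2 (m / S'.ncard) ≤ y - ε / 4 := by
    have h1 : m / S'.ncard ≤ m / (x * (1 + ε / 2)) := by gcongr
    have hS'0 : (0 : ℝ) < S'.ncard := lt_of_lt_of_le (by positivity) hS'card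
    refine (Real.logb_le_logb_of_le (by norm_num) (by positivity) h1).trans ?_
    rw [← div_div, Real.logb_div (by positivity) (by positivity), ← hy]
    have := half_le_logb_two_one_add (x := ε / 2) (by positivity) hε1
    linarith
  have hεy : δ / (16 * L * ℓ ^ 2) * y ≤ ε / 4 := by
    rw [hε, div_div, div_mul_eq_mul_div, div_le_div_iff₀ (by positivity) (by positivity)]
    have : δ * y * (L * ℓ ^ 2 * 4) ≤ δ * (4 * 2 ^ d) * (L * ℓ ^ 2 * 4) := by gcongr
    linarith
  linarith

/-- Vertices reached from `A` by walks of length at most `n` avoiding `W`. -/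
def reachAvoiding {V : Type*} (G : SimpleGraph V) (W A : Set V) (n : ℕ) : Set V :=
  {v | ∃ a ∈ A, ∃ p : G.Walk a v, p.length ≤ n ∧ ∀ x ∈ p.support, x ∉ W}

theorem reachAvoiding_mono {V : Type*} (G : SimpleGraph V) (W A : Set V) :
    Monotone (reachAvoiding G W A) := by
  rintro n k hnk v ⟨a, ha, p, hp, hpW⟩
  exact ⟨a, ha, p, hp.trans hnk, hpW⟩

theorem subset_reachAvoiding {V : Type*} {G : SimpleGraph V} {W A : Set V} (h : Disjoint A W)
    (n : ℕ) : A ⊆ reachAvoiding G W A n := fun a ha =>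
  ⟨a, ha, .nil, by simp, by simpa using Set.disjoint_left.1 h ha⟩

theorem nbhd_reachAvoiding_diff_subset {V : Type*} (G : SimpleGraph V) (W A : Set V) (n : ℕ) :
    nbhd G (reachAvoiding G W A n) \ W ⊆ reachAvoiding G W A (n + 1) := by
  rintro v ⟨⟨-, u, ⟨a, ha, p, hp, hpW⟩, huv⟩, hvW⟩
  refine ⟨a, ha, p.concat huv, by simpa using hp, ?_⟩
  intro x hx
  rw [SimpleGraph.Walk.support_concat, List.mem_append] at hx
  rcases hx with hx | hx
  · exact hpW x hx
  · rw [List.mem_singleton] at hx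
    exact hx ▸ hvW

theorem IsDeltaExpander.half_lt_card_reachAvoiding {V : Type*} [Finite V] {G : SimpleGraph V}
    {δ L ℓ : ℝ} (hG : IsDeltaExpander G δ) (hδ : 0 < δ) (hL : logb 2 (Nat.card V) = L)
    (hℓ : logb 2 L = ℓ) (hL2 : 2 ≤ L) (hℓ1 : 1 ≤ ℓ) (hδℓ : δ ≤ ℓ ^ 2) {A W : Set V}
    (hA : A.Nonempty) (hAW : Disjoint A W) (hW : 2 * L * ℓ ^ 2 * W.ncard ≤ δ * A.ncard)
    {n : ℕ} (hn : 16 * L * ℓ ^ 3 / δ < n) :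
    (Nat.card V : ℝ) / 2 < (reachAvoiding G W A n).ncard := by
  by_contra! hcon
  set c := δ / (16 * L * ℓ ^ 2) with hc
  have hc0 : 0 < c := by positivity
  have hc1 : c ≤ 1 := by
    rw [hc, div_le_one (by positivity)]
    nlinarith [sq_nonneg ℓ]
  have hmono : ∀ {i j}, i ≤ j →
      (reachAvoiding G W A i).ncard ≤ (reachAvoiding G W A j).ncard := fun h =>
    Set.ncard_le_ncard (reachAvoiding_mono G W A h) (Set.toFinite _)
  have hA0 : 0 < A.ncard := (Set.ncard_pos (Set.toFinite _)).2 hA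
  have hAle : ∀ i, A.ncard ≤ (reachAvoiding G W A i).ncard := fun i =>
    Set.ncard_le_ncard (subset_reachAvoiding hAW i) (Set.toFinite _)
  have hm0 : (0 : ℝ) < Nat.card V := by
    have := hA.some
    exact_mod_cast Nat.card_pos_iff.2 ⟨⟨this⟩, inferInstance⟩
  have hbound : ∀ i ≤ n, logb 2 ((Nat.card V : ℝ) / (reachAvoiding G W A i).ncard) ≤
      L * (1 - c) ^ i := by
    intro i
    induction i with
    | zero =>
      intro _
      have h1 : (1 : ℝ) ≤ (reachAvoiding G W A 0).ncard := by
        exact_mod_cast hA0.trans_le (hAle 0)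
      rw [pow_zero, mul_one, ← hL]
      exact Real.logb_le_logb_of_le (by norm_num) (by positivity) (div_le_self hm0.le h1)
    | succ i ih =>
      intro hi
      have hstep := hG.logb_card_div_le hδ hL hℓ hL2 hℓ1 hδℓ
        (S := reachAvoiding G W A i) (S' := reachAvoiding G W A (i + 1)) (W := W)
        (hA.mono (subset_reachAvoiding hAW i))
        (le_trans (by exact_mod_cast hmono (by omega)) hcon)
        (reachAvoiding_mono G W A (Nat.le_succ i)) (nbhd_reachAvoiding_diff_subset G W A i)
        (hW.trans (by have := hAle i; gcongr))
      refine hstep.trans ?_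
      rw [← hc, pow_succ]
      have := mul_le_mul_of_nonneg_left (ih (by omega)) (sub_nonneg.2 hc1)
      linarith
  have hx0 : (0 : ℝ) < (reachAvoiding G W A n).ncard := by
    exact_mod_cast hA0.trans_le (hAle n)
  have hge : 1 ≤ logb 2 ((Nat.card V : ℝ) / (reachAvoiding G W A n).ncard) := by
    rw [Real.le_logb_iff_rpow_le (by norm_num) (by positivity), Real.rpow_one, le_div_iff₀ hx0]
    linarith
  have hlt : L * (1 - c) ^ n < 1 := by
    have h1 : (1 - c) ^ n ≤ Real.exp (-(c * n)) := by
      have := pow_le_pow_left₀ (sub_nonneg.2 hc1) (Real.one_sub_le_exp_neg c) n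
      rwa [← Real.exp_nat_mul, mul_neg, mul_comm (n : ℝ)] at this
    have h2 : Real.log L ≤ ℓ := by
      rw [← hℓ, logb, le_div_iff₀ (Real.log_pos (by norm_num))]
      have h3 : Real.log 2 ≤ 1 := by linarith [Real.log_two_lt_d9]
      have h4 : 0 ≤ Real.log L := Real.log_nonneg (by linarith)
      nlinarith
    have h3 : ℓ < c * n := by
      rw [div_lt_iff₀ hδ] at hn
      rw [hc, div_mul_eq_mul_div, lt_div_iff₀ (by positivity)]
      linarith
    calc L * (1 - c) ^ n ≤ Real.exp (Real.log L) * Real.exp (-(c * n)) := by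
          rw [Real.exp_log (by linarith)]; gcongr
      _ = Real.exp (Real.log L - c * n) := by rw [← Real.exp_add, sub_eq_add_neg]
      _ < 1 := by rw [Real.exp_lt_one_iff]; linarith
  linarith [hbound n le_rfl]

/-- In an expander two sets much larger than `W` are joined by a short walk avoiding `W`. -/
theorem IsDeltaExpander.exists_walk_avoiding {V : Type*} [Finite V] {G : SimpleGraph V}
    {δ L ℓ : ℝ} (hG : IsDeltaExpander G δ) (hδ : 0 < δ) (hL : logb 2 (Nat.card V) = L)
    (hℓ : logb 2 L = ℓ) (hL2 : 2 ≤ L) (hℓ1 : 1 ≤ ℓ) (hδℓ : δ ≤ ℓ ^ 2) {A B W : Set V}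
    (hA : A.Nonempty) (hB : B.Nonempty) (hAW : Disjoint A W) (hBW : Disjoint B W)
    (hWA : 2 * L * ℓ ^ 2 * W.ncard ≤ δ * A.ncard) (hWB : 2 * L * ℓ ^ 2 * W.ncard ≤ δ * B.ncard)
    {n : ℕ} (hn : 16 * L * ℓ ^ 3 / δ < n) :
    ∃ a ∈ A, ∃ b ∈ B, ∃ p : G.Walk a b, p.length ≤ 2 * n ∧ ∀ x ∈ p.support, x ∉ W := by
  have h1 := hG.half_lt_card_reachAvoiding hδ hL hℓ hL2 hℓ1 hδℓ hA hAW hWA hn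
  have h2 := hG.half_lt_card_reachAvoiding hδ hL hℓ hL2 hℓ1 hδℓ hB hBW hWB hn
  have hmeet : ¬ Disjoint (reachAvoiding G W A n) (reachAvoiding G W B n) := by
    intro hdisj
    have h3 := Set.ncard_le_card (reachAvoiding G W A n ∪ reachAvoiding G W B n)
    rw [Set.ncard_union_eq hdisj (Set.toFinite _) (Set.toFinite _)] at h3
    have h4 : ((reachAvoiding G W A n).ncard : ℝ) + (reachAvoiding G W B n).ncard ≤
      Nat.card V := by exact_mod_cast h3
    linarith
  obtain ⟨z, ⟨a, ha, p, hp, hpW⟩, b, hb, p', hp', hpW'⟩ := Set.not_disjoint_iff.1 hmeet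
  refine ⟨a, ha, b, hb, p.append p'.reverse, ?_, ?_⟩
  · rw [SimpleGraph.Walk.length_append, SimpleGraph.Walk.length_reverse]
    omega
  · intro x hx
    rw [SimpleGraph.Walk.mem_support_append_iff, SimpleGraph.Walk.support_reverse,
      List.mem_reverse] at hx
    exact hx.elim (hpW x) (hpW' x)

theorem mem_gball_self {V : Type*} (G : SimpleGraph V) (v : V) (k : ℕ) : v ∈ gball G v k :=
  ⟨.nil, by simp⟩

theorem gball_mono {V : Type*} (G : SimpleGraph V) (v : V) : Monotone (gball G v) := by
  rintro i j hij u ⟨p, hp⟩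
  exact ⟨p, hp.trans hij⟩

theorem gball_zero {V : Type*} (G : SimpleGraph V) (v : V) : gball G v 0 = {v} := by
  ext u
  constructor
  · rintro ⟨p, hp⟩
    exact (SimpleGraph.Walk.eq_of_length_eq_zero (Nat.le_zero.1 hp)).symm
  · rintro rfl
    exact mem_gball_self G u 0

theorem gball_succ_subset {V : Type*} (G : SimpleGraph V) (v : V) (k : ℕ) :
    gball G v (k + 1) ⊆ ⋃ u ∈ gball G v k, insert u (G.neighborSet u) := by
  rintro u ⟨p, hp⟩
  rw [Set.mem_iUnion₂]
  by_cases hnil : p.Nil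
  · obtain rfl := hnil.eq
    exact ⟨v, mem_gball_self G v k, Set.mem_insert _ _⟩
  · refine ⟨p.penultimate, ⟨p.dropLast, ?_⟩, Or.inr (p.adj_penultimate hnil)⟩
    have := p.length_dropLast_add_one hnil
    omega

theorem ncard_gball_succ_le {V : Type*} [Finite V] {G : SimpleGraph V} {D : ℝ}
    (hdeg : ∀ x, ((G.neighborSet x).ncard : ℝ) ≤ D) (v : V) (k : ℕ) :
    ((gball G v (k + 1)).ncard : ℝ) ≤ (D + 1) * (gball G v k).ncard := by
  have hfin := Set.toFinite (gball G v k)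
  have hsub : gball G v (k + 1) ⊆ ⋃ u ∈ hfin.toFinset, insert u (G.neighborSet u) := by
    simpa using gball_succ_subset G v k
  have h1 := (Set.ncard_le_ncard hsub (Set.toFinite _)).trans (Finset.set_ncard_biUnion_le _ _)
  calc ((gball G v (k + 1)).ncard : ℝ)
      ≤ ∑ u ∈ hfin.toFinset, ((insert u (G.neighborSet u)).ncard : ℝ) := by exact_mod_cast h1
    _ ≤ ∑ u ∈ hfin.toFinset, (D + 1) := by
        refine Finset.sum_le_sum fun u _ => ?_
        have h2 : ((insert u (G.neighborSet u)).ncard : ℝ) ≤ (G.neighborSet u).ncard + 1 := by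
          exact_mod_cast Set.ncard_insert_le _ _
        linarith [hdeg u]
    _ = (D + 1) * (gball G v k).ncard := by
        rw [Finset.sum_const, nsmul_eq_mul, mul_comm, Set.ncard_eq_toFinset_card _ hfin]

theorem expanding_radius_le {V : Type*} [Finite V] {G : SimpleGraph V} {γ : ℝ} (hγ0 : 0 < γ)
    (hγ1 : γ ≤ 1) {v : V} {k : ℕ}
    (hexp : ∀ i : ℕ, 1 ≤ i → i + 1 ≤ k →
      ((gball G v (i + 1)).ncard : ℝ) ≥ (1 + γ) * (gball G v i).ncard) :
    (k : ℝ) ≤ 2 * logb 2 (Nat.card V) / γ + 1 := by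
  have hgrow : ∀ i, i + 1 ≤ k → (1 + γ) ^ i ≤ ((gball G v (i + 1)).ncard : ℝ) := by
    intro i
    induction i with
    | zero =>
      intro _
      have : 0 < (gball G v 1).ncard :=
        (Set.ncard_pos (Set.toFinite _)).2 ⟨v, mem_gball_self G v 1⟩
      simpa using Nat.succ_le_of_lt this
    | succ i ih =>
      intro hi
      have h1 := hexp (i + 1) (by omega) hi
      have h2 := mul_le_mul_of_nonneg_left (ih (by omega)) (by linarith : 0 ≤ 1 + γ)
      rw [pow_succ]
      linarith
  have hm1 : (1 : ℝ) ≤ Nat.card V := by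
    exact_mod_cast Nat.succ_le_of_lt (Nat.card_pos_iff.2 ⟨⟨v⟩, inferInstance⟩)
  have hlog0 : 0 ≤ logb 2 (Nat.card V) := Real.logb_nonneg (by norm_num) hm1
  rcases k with _ | k
  · have : 0 ≤ 2 * logb 2 (Nat.card V) / γ := by positivity
    push_cast
    linarith
  · have h1 : (1 + γ) ^ k ≤ (Nat.card V : ℝ) :=
      (hgrow k le_rfl).trans (by exact_mod_cast Set.ncard_le_card _)
    have h2 := Real.logb_le_logb_of_le (b := 2) (by norm_num) (by positivity) h1
    rw [Real.logb_pow] at h2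
    have h3 := mul_le_mul_of_nonneg_left (half_le_logb_two_one_add hγ0.le hγ1)
      (Nat.cast_nonneg (α := ℝ) k)
    push_cast
    have : (k : ℝ) ≤ 2 * logb 2 (Nat.card V) / γ := by
      rw [le_div_iff₀ hγ0]
      linarith
    linarith

theorem exists_walk_of_induce {V : Type*} {G : SimpleGraph V} {S : Set V} {a b : S}
    (p : (G.induce S).Walk a b) :
    ∃ p' : G.Walk (a : V) b, p'.length = p.length ∧
      ∀ y ∈ p'.support, ∃ z ∈ p.support, (z : V) = y := by
  induction p with
  | @nil u => exact ⟨.nil, rfl, fun y hy => ⟨u, by simp, (List.mem_singleton.1 hy).symm⟩⟩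
  | @cons u w z h p ih =>
    obtain ⟨p', hlen, hsupp⟩ := ih
    refine ⟨.cons (SimpleGraph.induce_adj.1 h) p', by simp [hlen], fun y hy => ?_⟩
    rw [SimpleGraph.Walk.support_cons, List.mem_cons] at hy
    rcases hy with rfl | hy
    · exact ⟨u, by simp, rfl⟩
    · obtain ⟨z, hz, rfl⟩ := hsupp y hy
      exact ⟨z, by simp [hz], rfl⟩

/-- Concentric balls in an expanding ball of bounded degree, with prescribed sizes up to a
factor `D + 1`. -/
theorem GraphIsExpandingBall.exists_nested_balls {V : Type*} [Finite V] {G : SimpleGraph V}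
    {S : Set V} {γ D : ℝ} (hball : GraphIsExpandingBall (G.induce S) γ) (hγ0 : 0 < γ)
    (hγ1 : γ ≤ 1) (hdeg : ∀ x : S, (((G.induce S).neighborSet x).ncard : ℝ) ≤ D)
    {M : ℕ → ℝ} (hM : Monotone M) (hM1 : ∀ r, 1 ≤ M r) {q : ℕ}
    (hq : 2 * logb 2 (Nat.card V) / γ + 1 ≤ q) :
    ∃ (v : V) (X : ℕ → Set V), (∀ r, X r ⊆ S) ∧ (∀ r, v ∈ X r) ∧ (∀ r, X r ⊆ X (r + 1)) ∧
      (∀ r, ((X r).ncard : ℝ) ≤ M r) ∧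
      (∀ r, M r < S.ncard → M r ≤ (D + 1) * (X r).ncard) ∧
      ∀ r, ∀ x ∈ X r, ∃ p : G.Walk v x, p.length ≤ q ∧ ∀ y ∈ p.support, y ∈ X r := by
  classical
  obtain ⟨v, k, huniv, hexp⟩ := hball
  set H := G.induce S with hH
  have hkq : k ≤ q := by
    have h1 := expanding_radius_le hγ0 hγ1 hexp
    have h0 : (0 : ℝ) < Nat.card S := by
      exact_mod_cast Nat.card_pos_iff.2 ⟨⟨v⟩, inferInstance⟩
    have h2 : (Nat.card S : ℝ) ≤ Nat.card V := by
      exact_mod_cast Nat.card_le_card_of_injective _ Subtype.val_injective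
    have h3 := Real.logb_le_logb_of_le (b := 2) (by norm_num) h0 h2
    have h4 : 2 * logb 2 (Nat.card S) / γ ≤ 2 * logb 2 (Nat.card V) / γ := by gcongr
    exact_mod_cast h1.trans (by linarith : _ ≤ (q : ℝ))
  set ρ : ℕ → ℕ := fun r => Nat.findGreatest (fun i => ((gball H v i).ncard : ℝ) ≤ M r) k with hρ
  have hρM : ∀ r, ((gball H v (ρ r)).ncard : ℝ) ≤ M r := fun r =>
    Nat.findGreatest_spec (P := fun i => ((gball H v i).ncard : ℝ) ≤ M r) (Nat.zero_le k)
      (by simpa [gball_zero] using hM1 r)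
  have hρk : ∀ r, ρ r ≤ k := fun r => Nat.findGreatest_le k
  have hcard : ∀ T : Set S, (Subtype.val '' T).ncard = T.ncard := fun T =>
    Set.ncard_image_of_injective T Subtype.val_injective
  refine ⟨v, fun r => Subtype.val '' gball H v (ρ r), ?_, ?_, ?_, ?_, ?_, ?_⟩
  · rintro r _ ⟨x, -, rfl⟩
    exact x.2
  · exact fun r => ⟨v, mem_gball_self H v _, rfl⟩
  · exact fun r => Set.image_mono (gball_mono H v
      (Nat.findGreatest_mono_left (fun i hi => hi.trans (hM (Nat.le_succ r))) k))
  · intro r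
    simpa only [hcard] using hρM r
  · intro r hr
    simp only [hcard]
    have hlt : ρ r < k := by
      refine lt_of_le_of_ne (hρk r) fun h => ?_
      have h1 := hρM r
      rw [h, huniv, Set.ncard_univ, Nat.card_coe_set_eq] at h1
      linarith
    have h2 := Nat.findGreatest_is_greatest (Nat.lt_succ_self (ρ r)) hlt
    exact (not_le.1 h2).le.trans (ncard_gball_succ_le hdeg v (ρ r))
  · rintro r _ ⟨x, ⟨p, hp⟩, rfl⟩
    obtain ⟨p', hlen, hsupp⟩ := exists_walk_of_induce p
    refine ⟨p', hlen.trans_le (hp.trans ((hρk r).trans hkq)), fun y hy => ?_⟩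
    obtain ⟨z, hz, rfl⟩ := hsupp y hy
    exact ⟨z, ⟨p.takeUntil z hz, (p.length_takeUntil_le_length hz).trans hp⟩, rfl⟩

open Filter in
theorem eventually_logb_large (a b : ℝ) (k : ℕ) : ∃ m₀ : ℕ, ∀ m : ℕ, m₀ ≤ m →
    a ≤ logb 2 m ∧ b ≤ logb 2 (logb 2 m) ∧ logb 2 m ^ k < (m : ℝ) ^ ((1 : ℝ) / 5) := by
  have hlog : Tendsto (fun x : ℝ => logb 2 x) atTop atTop := Real.tendsto_logb_atTop (by norm_num)
  have hpow : ∀ᶠ x : ℝ in atTop, logb 2 x ^ k < x ^ ((1 : ℝ) / 5) := by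
    have hlittle := isLittleO_log_rpow_rpow_atTop (k : ℝ) (by norm_num : (0 : ℝ) < 1 / 5)
    have hpos : 0 < Real.log 2 := Real.log_pos (by norm_num)
    have hc : 0 < Real.log 2 ^ k / 2 := by positivity
    filter_upwards [hlittle.def hc, eventually_gt_atTop 1] with x hx hx1
    have hlogx : 0 < Real.log x := Real.log_pos hx1
    rw [Real.rpow_natCast, Real.norm_of_nonneg (by positivity),
      Real.norm_of_nonneg (by positivity)] at hx
    have hx5 : 0 < x ^ ((1 : ℝ) / 5) := by positivity
    rw [logb, div_pow, div_lt_iff₀ (by positivity)]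
    have : 0 < Real.log 2 ^ k * x ^ ((1 : ℝ) / 5) := by positivity
    linarith
  have hall : ∀ᶠ x : ℝ in atTop,
      a ≤ logb 2 x ∧ b ≤ logb 2 (logb 2 x) ∧ logb 2 x ^ k < x ^ ((1 : ℝ) / 5) :=
    (hlog.eventually_ge_atTop a).and
      (((hlog.comp hlog).eventually_ge_atTop b).and hpow)
  exact eventually_atTop.1 (tendsto_natCast_atTop_atTop.eventually hall)

/-- Claim 3.7: a large `δ`-expander with `t` disjoint sets inducing `γ`-expanding balls of
polynomial size and bounded degree has a `K_t`-minor of order `O((t²/δ)·log m·(log log m)³)`. -/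
theorem stmt_8 :
    ∃ C : ℝ, 0 < C ∧
      ∀ δ : ℝ, 0 < δ → ∀ t : ℕ, 3 ≤ t → ∃ m₀ : ℕ,
        ∀ m : ℕ, m₀ ≤ m → ∀ G : SimpleGraph (Fin m), IsDeltaExpander G δ →
          ∀ S : Fin t → Set (Fin m),
            (Pairwise (Function.onFun Disjoint S)) →
            (∀ i, GraphIsExpandingBall (G.induce (S i)) (δ / (5 * (logb 2 (logb 2 m)) ^ 2)) ∧
              (m : ℝ) ^ ((1 : ℝ) / 5) ≤ ((S i).ncard : ℝ) ∧
              ((S i).ncard : ℝ) ≤ (m : ℝ) ^ ((1 : ℝ) / 4) ∧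
              ∀ x : (S i), (((G.induce (S i)).neighborSet x).ncard : ℝ) ≤ (logb 2 m) ^ 4) →
              HasKtMinorOfOrder G t
                (C * (t ^ 2 / δ) * logb 2 m * (logb 2 (logb 2 m)) ^ 3) := by
  refine ⟨61, by norm_num, fun δ hδ t ht => ?_⟩
  obtain ⟨m₀, hm₀⟩ := eventually_logb_large
    (2 + δ + 61 * t ^ 2 / δ + 4 * (t + 1) / δ) (1 + δ) (10 * (t ^ 2 + 1))
  refine ⟨m₀, fun m hm G hG S hS hball => ?_⟩
  obtain ⟨hLbig, hℓbig, hLm⟩ := hm₀ m hm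
  set L := logb 2 (m : ℝ) with hL
  set ℓ := logb 2 L with hℓ
  have htpos : (3 : ℝ) ≤ t := by exact_mod_cast ht
  have hterm1 : 0 ≤ 61 * (t : ℝ) ^ 2 / δ := by positivity
  have hterm2 : 0 ≤ 4 * ((t : ℝ) + 1) / δ := by positivity
  have hL2 : 2 ≤ L := by linarith
  have hL1 : 1 ≤ L := by linarith
  have hℓ1 : 1 ≤ ℓ := by linarith
  have hδℓ : δ ≤ ℓ ^ 2 := by nlinarith
  have hℓL : ℓ ≤ L := by
    rw [hℓ, Real.logb_le_iff_le_rpow (by norm_num) (by linarith)]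
    have h := one_add_mul_self_le_rpow_one_add (s := 1) (by norm_num) hL1
    norm_num at h
    linarith
  have hLδ : δ ≤ L := by linarith
  have hLN : 61 * (t : ℝ) ^ 2 ≤ L * δ := (div_le_iff₀ hδ).1 (by linarith)
  have hLt : 4 * ((t : ℝ) + 1) ≤ L * δ := (div_le_iff₀ hδ).1 (by linarith)
  set Z := L * ℓ ^ 3 / δ with hZ
  have hZ1 : 1 ≤ Z := by
    rw [hZ, le_div_iff₀ hδ]
    have : 1 ≤ ℓ ^ 3 := one_le_pow₀ hℓ1
    nlinarith
  set M : ℕ → ℝ := fun r => L ^ (10 * (r + 1)) with hMdef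
  have hM1 : ∀ r, 1 ≤ M r := fun r => one_le_pow₀ hL1
  have hM : Monotone M := fun r r' h => pow_le_pow_right₀ hL1 (by omega)
  have hMsucc : ∀ r, M (r + 1) = L ^ 10 * M r := fun r => by
    simp only [hMdef, ← pow_add]
    congr 1
    ring
  set γ := δ / (5 * ℓ ^ 2) with hγ
  have hγ0 : 0 < γ := by positivity
  have hγ1 : γ ≤ 1 := by
    rw [hγ, div_le_one (by positivity)]
    nlinarith
  set q := ⌈2 * L / γ + 1⌉₊ with hq
  set n := ⌊16 * L * ℓ ^ 3 / δ⌋₊ + 1 with hn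
  set N := t + t ^ 2 * (2 * n + 2 * q + 2) with hN
  have hqZ : (q : ℝ) ≤ 12 * Z := by
    have h1 : (q : ℝ) < 2 * L / γ + 1 + 1 := Nat.ceil_lt_add_one (by positivity)
    have h2 : 2 * L / γ ≤ 10 * Z := by
      rw [hγ, hZ, div_div_eq_mul_div, ← mul_div_assoc]
      have h3 : ℓ ^ 2 ≤ ℓ ^ 3 := pow_le_pow_right₀ hℓ1 (by norm_num)
      have h4 : 2 * L * (5 * ℓ ^ 2) ≤ 10 * (L * ℓ ^ 3) := by nlinarith
      gcongr
    linarith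
  have hnZ : (n : ℝ) ≤ 17 * Z := by
    have h1 : (⌊16 * L * ℓ ^ 3 / δ⌋₊ : ℝ) ≤ 16 * L * ℓ ^ 3 / δ := Nat.floor_le (by positivity)
    have h2 : 16 * L * ℓ ^ 3 / δ = 16 * Z := by rw [hZ]; ring
    rw [hn]
    push_cast
    linarith
  have hNZ : (N : ℝ) ≤ 61 * t ^ 2 * Z := by
    have h1 : (2 * n + 2 * q + 2 : ℝ) ≤ 60 * Z := by linarith
    have h2 : (t : ℝ) ^ 2 * (2 * n + 2 * q + 2) ≤ t ^ 2 * (60 * Z) := by gcongr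
    have h3 : (t : ℝ) ≤ t ^ 2 * Z := by nlinarith
    rw [hN]
    push_cast
    linarith
  have hNL : (N : ℝ) ≤ L ^ 10 := by
    have h1 : Z ≤ L * L ^ 3 / δ := by rw [hZ]; gcongr
    calc (N : ℝ) ≤ 61 * t ^ 2 * Z := hNZ
      _ ≤ L * δ * (L * L ^ 3 / δ) := by gcongr
      _ = L ^ 5 := by field_simp
      _ ≤ L ^ 10 := pow_le_pow_right₀ hL1 (by norm_num)
  choose v X hXS hvX hXmono hXM hMX hXroute using fun i =>
    (hball i).1.exists_nested_balls hγ0 hγ1 (hball i).2.2.2 hM hM1 (q := q)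
      (by rw [Nat.card_fin]; exact Nat.le_ceil _)
  have hXdisj : ∀ i j, i ≠ j → ∀ r, Disjoint (X i r) (X j r) := fun i j hij r =>
    (hS hij).mono (hXS i r) (hXS j r)
  have hlink : ∀ r < t ^ 2, ∀ i j, ∀ W A B : Set (Fin m), X i (r + 1) ⊆ A → X j (r + 1) ⊆ B →
      Disjoint A W → Disjoint B W → W.ncard ≤ ∑ k, (X k r).ncard + N →
      ∃ a ∈ A, ∃ b ∈ B, ∃ p : G.Walk a b, p.length ≤ 2 * n ∧ ∀ x ∈ p.support, x ∉ W := by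
    intro r hr i j W A B hA hB hAW hBW hW
    have hWM : (W.ncard : ℝ) ≤ (t + 1) * M r := by
      have h1 : (W.ncard : ℝ) ≤ ∑ k, ((X k r).ncard : ℝ) + N := by exact_mod_cast hW
      have h2 : ∑ k, ((X k r).ncard : ℝ) ≤ t * M r := by
        simpa using Finset.sum_le_card_nsmul Finset.univ _ _ fun k _ => hXM k r
      have h3 : L ^ 10 ≤ M r := pow_le_pow_right₀ hL1 (by omega)
      linarith
    have hlarge : ∀ k, ∀ U : Set (Fin m), X k (r + 1) ⊆ U →
        2 * L * ℓ ^ 2 * W.ncard ≤ δ * U.ncard := by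
      intro k U hU
      have h1 : M (r + 1) < (S k).ncard :=
        ((hM hr).trans_lt hLm).trans_le (hball k).2.1
      have h2 : ((X k (r + 1)).ncard : ℝ) ≤ U.ncard := by
        exact_mod_cast Set.ncard_le_ncard hU (Set.toFinite _)
      have h4 : (1 : ℝ) ≤ L ^ 4 := one_le_pow₀ hL1
      have h3 : M (r + 1) ≤ 2 * L ^ 4 * U.ncard := (hMX k _ h1).trans (by gcongr; linarith)
      have h5 : 2 * L ^ 4 * (2 * L * ℓ ^ 2 * W.ncard) ≤ 2 * L ^ 4 * (δ * U.ncard) := by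
        calc 2 * L ^ 4 * (2 * L * ℓ ^ 2 * W.ncard)
            ≤ 2 * L ^ 4 * (2 * L * L ^ 2 * ((t + 1) * M r)) := by gcongr
          _ = 4 * (t + 1) * (L ^ 7 * M r) := by ring
          _ ≤ L * δ * (L ^ 7 * M r) := by have := hM1 r; gcongr
          _ = δ * (L ^ 8 * M r) := by ring
          _ ≤ δ * (L ^ 10 * M r) := by
              have := hM1 r
              gcongr
              norm_num
          _ = δ * M (r + 1) := by rw [hMsucc]
          _ ≤ δ * (2 * L ^ 4 * U.ncard) := by gcongr
          _ = 2 * L ^ 4 * (δ * U.ncard) := by ring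
      exact le_of_mul_le_mul_left h5 (by positivity)
    exact hG.exists_walk_avoiding hδ (by rw [Nat.card_fin]) hℓ.symm hL2 hℓ1 hδℓ
      ⟨v i, hA (hvX i _)⟩ ⟨v j, hB (hvX j _)⟩ hAW hBW (hlarge i A hA) (hlarge j B hB)
      (by rw [hn]; push_cast; exact Nat.lt_floor_add_one _)
  set pairs := (Finset.univ.filter fun e : Fin t × Fin t => e.1 < e.2).toList with hpairs
  have hmem : ∀ e, e ∈ pairs ↔ e.1 < e.2 := fun e => by simp [hpairs]
  have hlen : pairs.length ≤ t ^ 2 := by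
    rw [hpairs, Finset.length_toList]
    refine (Finset.card_filter_le _ _).trans ?_
    simp [sq]
  have hstart : (⋃ i, {v i} : Set (Fin m)).ncard ≤ t := by
    rw [Set.iUnion_singleton_eq_range, ← Set.image_univ]
    simpa using Set.ncard_image_le (f := v) Set.finite_univ
  have hcost : pairs.length * (2 * n + 2 * q + 2) ≤ t ^ 2 * (2 * n + 2 * q + 2) :=
    Nat.mul_le_mul_right _ hlen
  obtain ⟨P, hvP, hPdisj, hPconn, hPadj, hPcard⟩ :=
    exists_linked_branch_sets hXdisj hXmono hXroute hlink pairs hlen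
      (fun e he => ((hmem e).1 he).ne) (fun i => {v i}) (fun i => rfl)
      (fun i j hij => (hXdisj i j hij 0).mono (by simpa using hvX i 0) (by simpa using hvX j 0))
      (fun i => by simp)
      (fun i j hij => (hXdisj i j hij _).mono_left (by simpa using hvX i _))
      (by omega)
  refine ⟨P, fun i => ⟨v i, hvP i rfl⟩, fun i j hij => hPdisj i j hij, hPconn,
    fun i j hij => hPadj (i, j) ((hmem _).2 hij), ?_⟩
  have hPN : ((⋃ i, P i).ncard : ℝ) ≤ N := by exact_mod_cast (by omega : _ ≤ N)
  refine (hPN.trans hNZ).trans (le_of_eq ?_)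
  rw [hZ]
  ring
end

section
/- There is an absolute constant C > 0 such that for all δ with 0 < δ < 1/4 and every integer t ≥ 3 there exists m₀ = m₀(δ,t) with the following property: if G is an m-vertex (δ,n)-expander with m ≥ m₀ and 2^{log n/(log log n)²} ≤ m ≤ n, then G contains a K_t-minor of order at most C·(t²/δ)·log n·log log n. -/
open Real

section AvoidingBall

variable {V : Type*} (G : SimpleGraph V)

/-- The ball of radius `k` around `A` in which every step after the start avoids `F`. -/
def avoidBall (F A : Set V) : ℕ → Set V
  | 0 => A
  | k + 1 => avoidBall F A k ∪ (nbhd G (avoidBall F A k) \ F)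

variable {G}

lemma avoidBall_mono_radius {F A : Set V} {j k : ℕ} (h : j ≤ k) :
    avoidBall G F A j ⊆ avoidBall G F A k :=
  monotone_nat_of_le_succ (f := avoidBall G F A) (fun _ => Set.subset_union_left) h

lemma subset_avoidBall (F A : Set V) (k : ℕ) : A ⊆ avoidBall G F A k :=
  avoidBall_mono_radius (G := G) (F := F) (A := A) (Nat.zero_le k)

lemma avoidBall_add (F A : Set V) (j k : ℕ) :
    avoidBall G F (avoidBall G F A j) k = avoidBall G F A (j + k) := by
  induction k with
  | zero => rfl
  | succ k ih => rw [← Nat.add_assoc, avoidBall, avoidBall, ih]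

lemma mem_avoidBall_succ_of_adj {F A : Set V} {k : ℕ} {y z : V} (hy : y ∈ avoidBall G F A k)
    (hyz : G.Adj y z) (hz : z ∉ F) : z ∈ avoidBall G F A (k + 1) := by
  by_cases h : z ∈ avoidBall G F A k
  · exact Or.inl h
  · exact Or.inr ⟨⟨h, y, hy, hyz⟩, hz⟩

/-- A ball avoiding `F₁` that stays clear of `F₂` is contained in the ball avoiding any subset of
`F₁ ∪ F₂`. -/
lemma avoidBall_subset_avoidBall {F F₁ F₂ A : Set V} (hF : F ⊆ F₁ ∪ F₂) {k : ℕ}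
    (h : Disjoint (avoidBall G F₁ A k) F₂) : avoidBall G F₁ A k ⊆ avoidBall G F A k := by
  induction k with
  | zero => exact subset_rfl
  | succ k ih =>
    have ih' := ih (h.mono_left (avoidBall_mono_radius k.le_succ))
    rintro z hz
    have hz₂ : z ∉ F₂ := Set.disjoint_left.1 h hz
    rcases hz with hz | ⟨⟨-, y, hy, hyz⟩, hz₁⟩
    · exact Or.inl (ih' hz)
    · exact mem_avoidBall_succ_of_adj (ih' hy) hyz fun hzF => (hF hzF).elim hz₁ hz₂

lemma avoidBall_anti {F F₁ : Set V} (hF : F ⊆ F₁) (A : Set V) (k : ℕ) :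
    avoidBall G F₁ A k ⊆ avoidBall G F A k :=
  avoidBall_subset_avoidBall (F₂ := ∅) (by simpa using hF) (Set.disjoint_empty _)

lemma disjoint_avoidBall {F A : Set V} (h : Disjoint A F) (k : ℕ) :
    Disjoint (avoidBall G F A k) F := by
  induction k with
  | zero => exact h
  | succ k ih => exact Set.disjoint_union_left.2 ⟨ih, Set.disjoint_sdiff_left⟩

lemma notMem_of_mem_avoidBall {F A : Set V} {k : ℕ} {z : V} (hz : z ∈ avoidBall G F A k)
    (hzA : z ∉ A) : z ∉ F := by
  induction k with
  | zero => exact absurd hz hzA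
  | succ k ih => exact hz.elim ih And.right

/-- Two balls avoiding `F` are disjoint when the centre of the second is far from the first. -/
lemma disjoint_avoidBall_avoidBall {F A A' : Set V} (hA' : Disjoint A' F) {j k : ℕ}
    (h : Disjoint (avoidBall G F A (j + k)) A') :
    Disjoint (avoidBall G F A j) (avoidBall G F A' k) := by
  induction k generalizing j with
  | zero => exact h
  | succ k ih =>
    rw [Set.disjoint_left]
    rintro z hz (hz' | ⟨⟨-, y, hy, hyz⟩, -⟩)
    · exact Set.disjoint_left.1 (ih (h.mono_left (avoidBall_mono_radius (by omega)))) hz hz'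
    · have hyF : y ∉ F := Set.disjoint_left.1 (disjoint_avoidBall hA' k) hy
      refine Set.disjoint_left.1 (ih (j := j + 1) ?_)
        (mem_avoidBall_succ_of_adj hz hyz.symm hyF) hy
      exact h.mono_left (avoidBall_mono_radius (by omega))

lemma induce_singleton_connected (v : V) : (G.induce {v}).Connected := by
  have : Nonempty ({v} : Set V) := ⟨⟨v, rfl⟩⟩
  exact ⟨SimpleGraph.Preconnected.of_subsingleton⟩

lemma induce_union_connected_of_adj {P Q : Set V} (hP : (G.induce P).Connected)
    (hQ : (G.induce Q).Connected) {u v : V} (hu : u ∈ P) (hv : v ∈ Q) (huv : G.Adj u v) :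
    (G.induce (P ∪ Q)).Connected := by
  have h₁ := SimpleGraph.induce_union_connected hP.preconnected
    (SimpleGraph.induce_pair_connected_of_adj huv).preconnected ⟨u, hu, by simp⟩
  have h₂ := SimpleGraph.induce_union_connected h₁.preconnected hQ.preconnected
    ⟨v, by simp, hv⟩
  convert h₂ using 2 <;>
  · ext x
    simp only [Set.mem_union, Set.mem_insert_iff, Set.mem_singleton_iff]
    grind

lemma ncard_insert_le_succ {P : Set V} {k : ℕ} (h : P.ncard ≤ k) (z : V) :
    (insert z P).ncard ≤ k + 1 :=
  (Set.ncard_insert_le z P).trans (Nat.succ_le_succ h)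

/-- A vertex of an avoiding ball is joined to the centre by a short path that stays in the ball
and avoids both the centre and the forbidden set. -/
lemma exists_connected_of_mem_avoidBall {F A : Set V} {k : ℕ} {z : V}
    (hz : z ∈ avoidBall G F A k) (hzA : z ∉ A) :
    ∃ P : Set V, (G.induce P).Connected ∧ z ∈ P ∧ Disjoint P A ∧ Disjoint P F ∧
      P ⊆ avoidBall G F A k ∧ P.ncard ≤ k ∧ ∃ u ∈ A, ∃ x ∈ P, G.Adj u x := by
  induction k generalizing z with
  | zero => exact absurd hz hzA
  | succ k ih =>
    have hzF := notMem_of_mem_avoidBall hz hzA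
    have hz' := hz
    rcases hz with hz | ⟨⟨-, y, hy, hyz⟩, -⟩
    · obtain ⟨P, hP, hzP, hPA, hPF, hPb, hc, hu⟩ := ih hz hzA
      exact ⟨P, hP, hzP, hPA, hPF, hPb.trans (avoidBall_mono_radius k.le_succ),
        hc.trans k.le_succ, hu⟩
    · by_cases hyA : y ∈ A
      · exact ⟨{z}, induce_singleton_connected z, rfl, by simpa using hzA, by simpa using hzF,
          by simpa using hz', by simp, y, hyA, z, rfl, hyz⟩
      · obtain ⟨P, hP, hyP, hPA, hPF, hPb, hc, u, hu, x, hx, hux⟩ := ih hy hyA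
        refine ⟨{z} ∪ P, induce_union_connected_of_adj (induce_singleton_connected z) hP rfl hyP
          hyz.symm, Or.inl rfl, ?_, ?_, ?_, ?_, u, hu, x, Or.inr hx, hux⟩
        · exact Set.disjoint_union_left.2 ⟨by simpa using hzA, hPA⟩
        · exact Set.disjoint_union_left.2 ⟨by simpa using hzF, hPF⟩
        · exact Set.union_subset (by simpa using hz')
            (hPb.trans (avoidBall_mono_radius k.le_succ))
        · exact ncard_insert_le_succ hc z

variable [Finite V]

lemma ncard_avoidBall_succ_ge {F A : Set V} {γ s : ℝ} {k : ℕ}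
    (hG : ∀ S : Set V, (S.ncard : ℝ) ≤ s → 2 * γ * S.ncard ≤ (nbhd G S).ncard)
    (hγ : 0 ≤ γ) (hF : (F.ncard : ℝ) ≤ γ * A.ncard)
    (hs : ((avoidBall G F A k).ncard : ℝ) ≤ s) :
    (1 + γ) * (avoidBall G F A k).ncard ≤ ((avoidBall G F A (k + 1)).ncard : ℝ) := by
  set X := avoidBall G F A k with hX
  have hAX : (A.ncard : ℝ) ≤ X.ncard := by
    exact_mod_cast Set.ncard_le_ncard (subset_avoidBall F A k)
  have hdisj : Disjoint X (nbhd G X \ F) :=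
    Set.disjoint_left.2 fun v hv hv' => hv'.1.1 hv
  have hcard : (avoidBall G F A (k + 1)).ncard = X.ncard + (nbhd G X \ F).ncard := by
    rw [avoidBall, Set.ncard_union_eq hdisj]
  have hsub : ((nbhd G X).ncard : ℝ) ≤ (nbhd G X \ F).ncard + F.ncard := by
    exact_mod_cast Set.ncard_le_ncard_sdiff_add_ncard _ _
  have := hG X hs
  have := mul_le_mul_of_nonneg_left hAX hγ
  rw [hcard]
  push_cast
  nlinarith

/-- Expansion at rate `2γ` up to size `s` makes an avoiding ball outgrow `s`, provided the
forbidden set is small. -/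
lemma lt_ncard_avoidBall {F A : Set V} {γ s : ℝ} {a N : ℕ}
    (hG : ∀ S : Set V, (S.ncard : ℝ) ≤ s → 2 * γ * S.ncard ≤ (nbhd G S).ncard)
    (hγ : 0 ≤ γ) (hF : (F.ncard : ℝ) ≤ γ * A.ncard) (hN : 1 ≤ N * γ)
    (hs : s < 2 ^ a * A.ncard) : s < (avoidBall G F A (a * N)).ncard := by
  by_contra! hle
  have key : ∀ k ≤ a * N, (1 + γ) ^ k * A.ncard ≤ ((avoidBall G F A k).ncard : ℝ) := by
    intro k
    induction k with
    | zero => intro _; simp [avoidBall]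
    | succ k ih =>
      intro hk
      have hks : ((avoidBall G F A k).ncard : ℝ) ≤ s := le_trans
        (by exact_mod_cast Set.ncard_le_ncard (avoidBall_mono_radius (by omega))) hle
      calc (1 + γ) ^ (k + 1) * A.ncard = (1 + γ) * ((1 + γ) ^ k * A.ncard) := by ring
        _ ≤ (1 + γ) * (avoidBall G F A k).ncard := by gcongr; exact ih (by omega)
        _ ≤ _ := ncard_avoidBall_succ_ge hG hγ hF hks
  have hpow : (2 : ℝ) ^ a ≤ (1 + γ) ^ (a * N) := by
    rw [mul_comm a N, pow_mul]
    have := one_add_mul_le_pow (a := γ) (by linarith) N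
    gcongr
    linarith
  have := key _ le_rfl
  have := mul_le_mul_of_nonneg_right hpow (Nat.cast_nonneg (α := ℝ) A.ncard)
  linarith

end AvoidingBall

section Hubs

variable {V : Type*} {G : SimpleGraph V}

/-- Greedy choice of pairwise disjoint small sets. -/
lemma exists_pairwiseDisjoint_of_forall_avoiding {ι : Type*} {p : ι → Set V → Prop} {q : ℕ}
    (s : Finset ι)
    (h : ∀ e ∈ s, ∀ F : Set V, F.ncard ≤ s.card * q →
      ∃ Q : Set V, p e Q ∧ Q.ncard ≤ q ∧ Disjoint Q F) :
    ∃ Q : ι → Set V, (∀ e ∈ s, p e (Q e) ∧ (Q e).ncard ≤ q) ∧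
      (s : Set ι).PairwiseDisjoint Q := by
  classical
  induction s using Finset.induction_on with
  | empty => exact ⟨fun _ => ∅, by simp, by simp⟩
  | insert a s ha ih =>
    have hcard : (insert a s).card = s.card + 1 := Finset.card_insert_of_notMem ha
    obtain ⟨Q, hQ, hdisj⟩ := ih fun e he F hF =>
      h e (Finset.mem_insert_of_mem he) F (hF.trans (Nat.mul_le_mul_right q (by omega)))
    have hU : (⋃ e ∈ s, Q e).ncard ≤ s.card * q :=
      (s.set_ncard_biUnion_le Q).trans (Finset.sum_le_card_nsmul _ _ _ fun e he => (hQ e he).2)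
    obtain ⟨Q₀, hp, hq, hd⟩ := h a (Finset.mem_insert_self a s) (⋃ e ∈ s, Q e)
      (hU.trans (Nat.mul_le_mul_right q (by omega)))
    have hne : ∀ e ∈ s, e ≠ a := fun e he h => ha (h ▸ he)
    refine ⟨Function.update Q a Q₀, fun e he => ?_, ?_⟩
    · rcases Finset.mem_insert.1 he with rfl | he
      · simpa using ⟨hp, hq⟩
      · simpa [hne e he] using hQ e he
    · have hd' : ∀ e ∈ s, Disjoint Q₀ (Q e) := fun e he =>
        hd.mono_right (Set.subset_biUnion_of_mem (u := Q) he)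
      intro e he f hf hef
      simp only [Finset.coe_insert, Set.mem_insert_iff, Finset.mem_coe] at he hf
      simp only [Function.onFun]
      rcases he with rfl | he <;> rcases hf with rfl | hf
      · exact absurd rfl hef
      · simpa [hne f hf] using hd' f hf
      · simpa [hne e he] using (hd' e he).symm
      · simpa [hne e he, hne f hf] using hdisj he hf hef

lemma IsDeltaNExpander.le_ncard_nbhd {δ : ℝ} {n d : ℕ} (hG : IsDeltaNExpander G δ n)
    (hd : (2 : ℝ) ^ d ≤ logb 2 (Nat.card V) / 2) {S : Set V}
    (hS : (S.ncard : ℝ) ≤ (Nat.card V : ℝ) / 2 ^ (2 ^ d : ℕ)) :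
    δ * 2 ^ d / logb 2 n * S.ncard ≤ (nbhd G S).ncard := by
  refine hG d ?_ S hS
  have hpos : (0 : ℝ) < 2 ^ d := by positivity
  have h : (2 : ℝ) ^ (d + 1) ≤ logb 2 (Nat.card V) := by rw [pow_succ]; linarith
  have h' := Real.logb_le_logb_of_le (b := 2) (by norm_num) (by positivity) h
  rw [Real.logb_pow, Real.logb_self_eq_one (by norm_num)] at h'
  push_cast at h'
  linarith

variable [Finite V]

/-- Disjoint hubs with centres, in which every vertex is cheaply connected to the centre, yield a
small complete minor as soon as any two of them can be robustly joined outside all hubs. -/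
lemma hasKtMinorOfOrder_of_hubs {t κ q : ℕ} (U : Fin t → Set V) (c : Fin t → V)
    (hU : Pairwise (Function.onFun Disjoint U)) (hc : ∀ i, c i ∈ U i)
    (hW : ∀ i, ∀ u ∈ U i, ∃ W ⊆ U i, (G.induce W).Connected ∧ c i ∈ W ∧ u ∈ W ∧ W.ncard ≤ κ)
    (hQ : ∀ i j : Fin t, i < j → ∀ F : Set V, F.ncard ≤ t ^ 2 * q →
      ∃ Q : Set V, ((G.induce Q).Connected ∧ (∀ k, Disjoint Q (U k)) ∧
        (∃ u ∈ U i, ∃ x ∈ Q, G.Adj u x) ∧ ∃ u ∈ U j, ∃ x ∈ Q, G.Adj u x) ∧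
        Q.ncard ≤ q ∧ Disjoint Q F) :
    HasKtMinorOfOrder G t ((t ^ 2 * (2 * κ + q) + t : ℕ) : ℝ) := by
  classical
  let E : Finset (Fin t × Fin t) := Finset.univ.filter fun e => e.1 < e.2
  have hE : E.card ≤ t ^ 2 := (Finset.card_le_univ E).trans (by simp [sq])
  have hmem : ∀ e, e ∈ E ↔ e.1 < e.2 := fun e => by simp [E]
  obtain ⟨Q, hQE, hQdisj⟩ := exists_pairwiseDisjoint_of_forall_avoiding (V := V)
    (p := fun e : Fin t × Fin t => fun Q => (G.induce Q).Connected ∧ (∀ k, Disjoint Q (U k)) ∧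
        (∃ u ∈ U e.1, ∃ x ∈ Q, G.Adj u x) ∧ ∃ u ∈ U e.2, ∃ x ∈ Q, G.Adj u x) (q := q) E
    fun e he F hF => hQ e.1 e.2 ((hmem e).1 he) F (hF.trans (Nat.mul_le_mul_right q hE))
  have hleft : ∀ e : Fin t × Fin t, ∃ W : Set V, e ∈ E → W ⊆ U e.1 ∧ (G.induce W).Connected ∧
      c e.1 ∈ W ∧ W.ncard ≤ κ ∧ ∃ u ∈ W, ∃ x ∈ Q e, G.Adj u x := by
    intro e
    by_cases he : e ∈ E
    · obtain ⟨⟨-, -, ⟨u, hu, x, hx, hux⟩, -⟩, -⟩ := hQE e he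
      obtain ⟨W, hWU, hWc, hcW, huW, hκ⟩ := hW e.1 u hu
      exact ⟨W, fun _ => ⟨hWU, hWc, hcW, hκ, u, huW, x, hx, hux⟩⟩
    · exact ⟨∅, fun h => absurd h he⟩
  have hright : ∀ e : Fin t × Fin t, ∃ W : Set V, e ∈ E → W ⊆ U e.2 ∧ (G.induce W).Connected ∧
      c e.2 ∈ W ∧ W.ncard ≤ κ ∧ ∃ u ∈ W, ∃ x ∈ Q e, G.Adj u x := by
    intro e
    by_cases he : e ∈ E
    · obtain ⟨⟨-, -, -, ⟨u, hu, x, hx, hux⟩⟩, -⟩ := hQE e he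
      obtain ⟨W, hWU, hWc, hcW, huW, hκ⟩ := hW e.2 u hu
      exact ⟨W, fun _ => ⟨hWU, hWc, hcW, hκ, u, huW, x, hx, hux⟩⟩
    · exact ⟨∅, fun h => absurd h he⟩
  choose A hA using hleft
  choose B hB using hright
  let P : Fin t → Set V := fun i => {v | v = c i ∨
    (∃ e ∈ E, e.1 = i ∧ v ∈ A e ∪ Q e) ∨ ∃ e ∈ E, e.2 = i ∧ v ∈ B e}
  have hPmem : ∀ i v, v ∈ P i → v ∈ U i ∨ ∃ e ∈ E, e.1 = i ∧ v ∈ Q e := by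
    rintro i v (rfl | ⟨e, he, rfl, hv | hv⟩ | ⟨e, he, rfl, hv⟩)
    · exact Or.inl (hc i)
    · exact Or.inl ((hA e he).1 hv)
    · exact Or.inr ⟨e, he, rfl, hv⟩
    · exact Or.inl ((hB e he).1 hv)
  refine ⟨P, fun i => ⟨c i, Or.inl rfl⟩, ?_, ?_, ?_, ?_⟩
  · intro i j hij
    refine Set.disjoint_left.2 fun v hvi hvj => ?_
    rcases hPmem i v hvi with hi | ⟨e, he, rfl, hi⟩ <;>
      rcases hPmem j v hvj with hj | ⟨f, hf, rfl, hj⟩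
    · exact Set.disjoint_left.1 (hU hij) hi hj
    · exact Set.disjoint_left.1 ((hQE f hf).1.2.1 i) hj hi
    · exact Set.disjoint_left.1 ((hQE e he).1.2.1 j) hi hj
    · exact Set.disjoint_left.1 (hQdisj he hf fun h => hij (by rw [h])) hi hj
  · intro i
    refine SimpleGraph.induce_connected_of_patches (c i) (Or.inl rfl) ?_
    rintro v (rfl | ⟨e, he, rfl, hv⟩ | ⟨e, he, rfl, hv⟩)
    · exact ⟨{c i}, by rintro _ rfl; exact Or.inl rfl, rfl, rfl, SimpleGraph.Reachable.refl _⟩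
    · obtain ⟨-, hAc, hcA, -, u, hu, x, hx, hux⟩ := hA e he
      exact ⟨A e ∪ Q e, fun w hw => Or.inr (Or.inl ⟨e, he, rfl, hw⟩), Or.inl hcA, hv,
        (induce_union_connected_of_adj hAc (hQE e he).1.1 hu hx hux) _ _⟩
    · obtain ⟨-, hBc, hcB, -, -⟩ := hB e he
      exact ⟨B e, fun w hw => Or.inr (Or.inr ⟨e, he, rfl, hw⟩), hcB, hv, hBc _ _⟩
  · intro i j hij
    have he : (i, j) ∈ E := (hmem _).2 hij
    obtain ⟨-, -, -, -, u, hu, x, hx, hux⟩ := hB (i, j) he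
    exact ⟨x, Or.inr (Or.inl ⟨(i, j), he, rfl, Or.inr hx⟩), u,
      Or.inr (Or.inr ⟨(i, j), he, rfl, hu⟩), hux.symm⟩
  · have hsub : (⋃ i, P i) ⊆ (⋃ e ∈ E, (A e ∪ Q e ∪ B e)) ∪ Set.range c := by
      intro v hv
      obtain ⟨i, rfl | ⟨e, he, -, hv⟩ | ⟨e, he, -, hv⟩⟩ := Set.mem_iUnion.1 hv
      · exact Or.inr ⟨i, rfl⟩
      · exact Or.inl (Set.mem_biUnion he (Or.inl hv))
      · exact Or.inl (Set.mem_biUnion he (Or.inr hv))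
    have hpiece : ∀ e ∈ E, (A e ∪ Q e ∪ B e).ncard ≤ 2 * κ + q := by
      intro e he
      have h₁ := Set.ncard_union_le (A e ∪ Q e) (B e)
      have h₂ := Set.ncard_union_le (A e) (Q e)
      have h₃ := (hA e he).2.2.2.1
      have h₄ := (hB e he).2.2.2.1
      have h₅ := (hQE e he).2
      omega
    have hbig : (⋃ e ∈ E, (A e ∪ Q e ∪ B e)).ncard ≤ t ^ 2 * (2 * κ + q) :=
      (E.set_ncard_biUnion_le _).trans ((Finset.sum_le_card_nsmul _ _ _ hpiece).trans
        (Nat.mul_le_mul_right _ hE))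
    have hrange : (Set.range c).ncard ≤ t := by
      rw [← Set.image_univ]
      exact (Set.ncard_image_le).trans (by simp [Set.ncard_univ])
    exact_mod_cast (Set.ncard_le_ncard hsub).trans
      ((Set.ncard_union_le _ _).trans (Nat.add_le_add hbig hrange))

/-- Growth of an avoiding ball within a single scale of the expansion condition. -/
lemma IsDeltaNExpander.lt_ncard_avoidBall_of_scale {δ : ℝ} {n d j N₀ : ℕ}
    (hG : IsDeltaNExpander G δ n) (hδ : 0 < δ) (hδ1 : δ ≤ 1)
    (hd : (2 : ℝ) ^ d ≤ logb 2 (Nat.card V) / 2) (hmn : logb 2 (Nat.card V) ≤ logb 2 n)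
    (hN₀ : 3 * logb 2 n / δ ≤ N₀) {F A : Set V}
    (hF : (F.ncard : ℝ) ≤ δ / (2 * logb 2 n) * A.ncard)
    (hA : (Nat.card V : ℝ) / 2 ^ (2 ^ d : ℕ) < 2 ^ (j * 2 ^ d) * A.ncard) :
    (Nat.card V : ℝ) / 2 ^ (2 ^ d : ℕ) < (avoidBall G F A (j * N₀)).ncard := by
  set L := logb 2 n with hL
  have hd1 : (1 : ℝ) ≤ 2 ^ d := one_le_pow₀ (by norm_num)
  have hL0 : 0 < L := by linarith
  set N := ⌈2 * L / (δ * 2 ^ d)⌉₊ with hN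
  have hNub : (N : ℝ) < 2 * L / (δ * 2 ^ d) + 1 := Nat.ceil_lt_add_one (by positivity)
  have hNlb : 2 * L / (δ * 2 ^ d) ≤ N := Nat.le_ceil _
  have hsteps : j * 2 ^ d * N ≤ j * N₀ := by
    rw [mul_assoc]
    refine Nat.mul_le_mul_left j ?_
    have hLδ : L ≤ L / δ := by rw [le_div_iff₀ hδ]; nlinarith
    have : (2 : ℝ) ^ d * N ≤ N₀ := by
      calc (2 : ℝ) ^ d * N ≤ 2 ^ d * (2 * L / (δ * 2 ^ d) + 1) := by gcongr
        _ = 2 * (L / δ) + 2 ^ d := by field_simp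
        _ ≤ 3 * L / δ := by rw [mul_div_assoc]; linarith
        _ ≤ N₀ := hN₀
    exact_mod_cast this
  have key : (Nat.card V : ℝ) / 2 ^ (2 ^ d : ℕ) < (avoidBall G F A (j * 2 ^ d * N)).ncard := by
    refine lt_ncard_avoidBall (γ := δ * 2 ^ d / (2 * L)) (fun S hS => ?_) (by positivity) ?_ ?_ hA
    · refine le_trans (le_of_eq ?_) (hG.le_ncard_nbhd hd hS)
      rw [← hL]
      field_simp
    · refine hF.trans ?_
      gcongr
      nlinarith
    · calc (1 : ℝ) = 2 * L / (δ * 2 ^ d) * (δ * 2 ^ d / (2 * L)) := by field_simp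
        _ ≤ N * (δ * 2 ^ d / (2 * L)) := by gcongr
  refine key.trans_le ?_
  exact_mod_cast Set.ncard_le_ncard (avoidBall_mono_radius hsteps)

/-- Growth of an avoiding ball, through all scales, to more than half of the vertices. -/
lemma IsDeltaNExpander.half_lt_ncard_avoidBall {δ : ℝ} {n D N₀ : ℕ}
    (hG : IsDeltaNExpander G δ n) (hδ : 0 < δ) (hδ1 : δ ≤ 1)
    (hD : (2 : ℝ) ^ D ≤ logb 2 (Nat.card V) / 2) (hD' : logb 2 (Nat.card V) ≤ 4 * 2 ^ D)
    (hmn : logb 2 (Nat.card V) ≤ logb 2 n) (hN₀ : 3 * logb 2 n / δ ≤ N₀) {F A : Set V}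
    (hF : (F.ncard : ℝ) ≤ δ / (2 * logb 2 n) * A.ncard) (hA : A.Nonempty) :
    (Nat.card V : ℝ) / 2 < (avoidBall G F A ((4 + D) * N₀)).ncard := by
  have hA1 : (1 : ℝ) ≤ A.ncard := by exact_mod_cast (Set.ncard_pos).2 hA
  have hL0 : 0 < logb 2 (n : ℝ) := by
    have : (0 : ℝ) < 2 ^ D := by positivity
    linarith
  have hpos : (0 : ℝ) < Nat.card V := by
    have : Nonempty V := hA.to_type
    exact_mod_cast Nat.card_pos
  have main : ∀ e ≤ D, (Nat.card V : ℝ) / 2 ^ (2 ^ (D - e) : ℕ) <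
      (avoidBall G F A ((4 + e) * N₀)).ncard := by
    intro e
    induction e with
    | zero =>
      intro _
      refine hG.lt_ncard_avoidBall_of_scale hδ hδ1 hD hmn hN₀ hF ?_
      have h₁ : (Nat.card V : ℝ) ≤ 2 ^ (4 * 2 ^ D) := by
        rw [Real.logb_le_iff_le_rpow (by norm_num) hpos] at hD'
        exact_mod_cast hD'
      have h₂ : (Nat.card V : ℝ) / 2 ^ (2 ^ D : ℕ) < Nat.card V :=
        div_lt_self hpos (one_lt_pow₀ (by norm_num) (by positivity))
      have h₃ : (0 : ℝ) < 2 ^ (4 * 2 ^ D) := by positivity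
      nlinarith
    | succ e ih =>
      intro he
      have ih' := ih (by omega)
      have hexp : D - e = (D - (e + 1)) + 1 := by omega
      have hstep : ((4 + (e + 1)) * N₀) = (4 + e) * N₀ + 1 * N₀ := by ring
      rw [hstep, ← avoidBall_add]
      refine hG.lt_ncard_avoidBall_of_scale hδ hδ1 ?_ hmn hN₀ ?_ ?_
      · refine le_trans ?_ hD
        gcongr
        · norm_num
        · omega
      · refine hF.trans ?_
        gcongr
        · exact Set.toFinite _
        · exact subset_avoidBall F A _
      · rw [hexp, pow_succ 2 (D - (e + 1)), pow_mul, sq, ← div_div,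
          div_lt_iff₀ (by positivity)] at ih'
        rw [one_mul]
        linarith
  simpa using main D le_rfl

/-- Hubs whose avoiding balls robustly reach a size `Z` that dwarfs all obstacles yield a small
complete minor. -/
lemma IsDeltaNExpander.hasKtMinorOfOrder_of_hubs {δ : ℝ} {n D N₀ t κ R Z : ℕ}
    (hG : IsDeltaNExpander G δ n) (hδ : 0 < δ) (hδ1 : δ ≤ 1)
    (hD : (2 : ℝ) ^ D ≤ logb 2 (Nat.card V) / 2) (hD' : logb 2 (Nat.card V) ≤ 4 * 2 ^ D)
    (hmn : logb 2 (Nat.card V) ≤ logb 2 n) (hN₀ : 3 * logb 2 n / δ ≤ N₀)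
    (U : Fin t → Set V) (c : Fin t → V)
    (hU : Pairwise (Function.onFun Disjoint U)) (hc : ∀ i, c i ∈ U i)
    (hW : ∀ i, ∀ u ∈ U i, ∃ W ⊆ U i, (G.induce W).Connected ∧ c i ∈ W ∧ u ∈ W ∧ W.ncard ≤ κ)
    (hgrow : ∀ i, ∀ F : Set V, F.ncard ≤ t ^ 2 * (2 * (R + (4 + D) * N₀)) →
      Z ≤ (avoidBall G (F ∪ ⋃ k ∈ {k | k ≠ i}, U k) (U i) R).ncard)
    (hZ : ((t ^ 2 * (2 * (R + (4 + D) * N₀)) + (⋃ k, U k).ncard : ℕ) : ℝ) ≤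
      δ / (2 * logb 2 n) * Z) :
    HasKtMinorOfOrder G t ((t ^ 2 * (2 * κ + 2 * (R + (4 + D) * N₀)) + t : ℕ) : ℝ) := by
  have hL0 : 0 < logb 2 (n : ℝ) := by
    have : (0 : ℝ) < 2 ^ D := by positivity
    linarith
  refine _root_.hasKtMinorOfOrder_of_hubs U c hU hc hW fun i j hij F hF => ?_
  have hbig : ∀ i, (Nat.card V : ℝ) / 2 <
      (avoidBall G (F ∪ ⋃ k ∈ {k | k ≠ i}, U k) (U i) (R + (4 + D) * N₀)).ncard := by
    intro i
    rw [← avoidBall_add]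
    refine hG.half_lt_ncard_avoidBall hδ hδ1 hD hD' hmn hN₀ ?_
      ⟨c i, subset_avoidBall _ _ _ (hc i)⟩
    refine le_trans ?_ (hZ.trans ?_)
    · have h₁ := Set.ncard_union_le F (⋃ k ∈ {k | k ≠ i}, U k)
      have h₂ : (⋃ k ∈ {k | k ≠ i}, U k).ncard ≤ (⋃ k, U k).ncard :=
        Set.ncard_le_ncard (Set.iUnion₂_subset_iUnion _ _)
      exact_mod_cast h₁.trans (Nat.add_le_add hF h₂)
    · gcongr
      exact hgrow i F hF
  obtain ⟨z, hzi, hzj⟩ : (avoidBall G (F ∪ ⋃ k ∈ {k | k ≠ i}, U k) (U i) (R + (4 + D) * N₀) ∩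
      avoidBall G (F ∪ ⋃ k ∈ {k | k ≠ j}, U k) (U j) (R + (4 + D) * N₀)).Nonempty := by
    rw [← Set.not_disjoint_iff_nonempty_inter]
    intro hdisj
    have h₁ := Set.ncard_union_eq hdisj
    have h₂ := Set.ncard_le_card (avoidBall G (F ∪ ⋃ k ∈ {k | k ≠ i}, U k) (U i)
      (R + (4 + D) * N₀) ∪ avoidBall G (F ∪ ⋃ k ∈ {k | k ≠ j}, U k) (U j) (R + (4 + D) * N₀))
    rw [h₁] at h₂
    have h₃ : ((_ + _ : ℕ) : ℝ) ≤ _ := Nat.cast_le.2 h₂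
    push_cast at h₃
    linarith [hbig i, hbig j]
  have hout : ∀ {a b : Fin t}, a ≠ b →
      U a ⊆ F ∪ ⋃ k ∈ {k | k ≠ b}, U k := fun {a b} hab x hx =>
    Or.inr (Set.mem_biUnion (x := a) hab hx)
  have hzUj : z ∉ U j := fun h => notMem_of_mem_avoidBall hzi
    (Set.disjoint_left.1 (hU hij.ne') h) (hout hij.ne' h)
  have hzUi : z ∉ U i := fun h => notMem_of_mem_avoidBall hzj
    (Set.disjoint_left.1 (hU hij.ne) h) (hout hij.ne h)
  obtain ⟨P, hP, hzP, hPU, hPF, -, hPc, u, hu, x, hx, hux⟩ :=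
    exists_connected_of_mem_avoidBall hzi hzUi
  obtain ⟨P', hP', hzP', hPU', hPF', -, hPc', u', hu', x', hx', hux'⟩ :=
    exists_connected_of_mem_avoidBall hzj hzUj
  have hclear : ∀ {a : Fin t} {P : Set V}, Disjoint P (U a) →
      Disjoint P (F ∪ ⋃ k ∈ {k | k ≠ a}, U k) → ∀ k, Disjoint P (U k) := by
    intro a P h₁ h₂ k
    by_cases hka : k = a
    · exact hka ▸ h₁
    · exact h₂.mono_right (hout hka)
  refine ⟨P ∪ P', ⟨SimpleGraph.induce_union_connected hP.preconnected hP'.preconnected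
    ⟨z, hzP, hzP'⟩, fun k => Set.disjoint_union_left.2 ⟨hclear hPU hPF k, hclear hPU' hPF' k⟩,
    ⟨u, hu, x, Or.inl hx, hux⟩, u', hu', x', Or.inr hx', hux'⟩, ?_, ?_⟩
  · exact (Set.ncard_union_le P P').trans (by omega)
  · exact Set.disjoint_union_left.2 ⟨hPF.mono_right Set.subset_union_left,
      hPF'.mono_right Set.subset_union_left⟩

end Hubs

section HubConstruction

variable {V : Type*} (G : SimpleGraph V)

/-- There are `t` disjoint hubs, of total size at most `u`, each with a centre to which every
vertex of the hub is connected by at most `κ` vertices, and such that the `R`-ball around any hub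
that avoids the other hubs and any `B` further vertices has size at least `Z`. -/
def HasHubs (t κ B R Z u : ℕ) : Prop :=
  ∃ (U : Fin t → Set V) (c : Fin t → V), Pairwise (Function.onFun Disjoint U) ∧
    (∀ i, c i ∈ U i) ∧
    (∀ i, ∀ u ∈ U i, ∃ W ⊆ U i, (G.induce W).Connected ∧ c i ∈ W ∧ u ∈ W ∧ W.ncard ≤ κ) ∧
    (∀ i, ∀ F : Set V, F.ncard ≤ B →
      Z ≤ (avoidBall G (F ∪ ⋃ k ∈ {k | k ≠ i}, U k) (U i) R).ncard) ∧
    (⋃ k, U k).ncard ≤ u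

/-- The vertices of degree at least `Δ`. -/
def highDegree (Δ : ℕ) : Set V := {v | Δ ≤ (nbhd G {v}).ncard}

variable {G} [Finite V]

lemma hasHubs_of_le_ncard_highDegree {t κ B R Z Δ : ℕ} (hT : t ≤ (highDegree G Δ).ncard)
    (hΔ : Z + B + t ≤ Δ) (hR : 1 ≤ R) (hκ : 1 ≤ κ) : HasHubs G t κ B R Z t := by
  classical
  have := Fintype.ofFinite (highDegree G Δ)
  obtain ⟨f⟩ : Nonempty (Fin t ↪ highDegree G Δ) :=
    Function.Embedding.nonempty_of_card_le (by
      rwa [Fintype.card_fin, ← Nat.card_eq_fintype_card, Nat.card_coe_set_eq])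
  have hunion : (⋃ k, {(f k : V)}).ncard ≤ t := by
    rw [Set.iUnion_singleton_eq_range, ← Set.image_univ]
    exact (Set.ncard_image_le).trans (by simp [Set.ncard_univ])
  refine ⟨fun i => {(f i : V)}, fun i => f i, ?_, fun i => rfl, ?_, ?_, hunion⟩
  · intro i j hij
    simpa [Function.onFun, Subtype.coe_inj] using hij
  · rintro i u rfl
    exact ⟨{(f i : V)}, subset_rfl, induce_singleton_connected _, rfl, rfl, by simpa using hκ⟩
  · intro i F hF
    set F' := F ∪ ⋃ k ∈ {k | k ≠ i}, {(f k : V)} with hF'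
    have h₁ : F'.ncard ≤ B + t := (Set.ncard_union_le _ _).trans (Nat.add_le_add hF
      ((Set.ncard_le_ncard (Set.iUnion₂_subset_iUnion _ _)).trans hunion))
    have h₂ : nbhd G {(f i : V)} \ F' ⊆ avoidBall G F' {(f i : V)} R :=
      subset_trans Set.subset_union_right (avoidBall_mono_radius (j := 1) hR)
    have h₃ := Set.ncard_le_ncard h₂
    have h₄ := Set.ncard_le_ncard_sdiff_add_ncard (nbhd G {(f i : V)}) F'
    have h₅ : Δ ≤ (nbhd G {(f i : V)}).ncard := (f i).2
    change Z ≤ (avoidBall G F' {(f i : V)} R).ncard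
    omega

lemma ncard_nbhd_le {S : Set V} {Δ : ℕ} (h : ∀ v ∈ S, (nbhd G {v}).ncard ≤ Δ) :
    (nbhd G S).ncard ≤ S.ncard * Δ := by
  classical
  have hsub : nbhd G S ⊆ ⋃ v ∈ S.toFinite.toFinset, nbhd G {v} := by
    rintro w ⟨hw, u, hu, huw⟩
    refine Set.mem_biUnion (x := u) (by simpa using hu) ⟨?_, u, rfl, huw⟩
    rintro rfl
    exact hw hu
  refine (Set.ncard_le_ncard hsub).trans ((Finset.set_ncard_biUnion_le _ _).trans ?_)
  rw [Set.ncard_eq_toFinset_card S]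
  exact Finset.sum_le_card_nsmul _ _ _ fun v hv => h v (by simpa using hv)

lemma ncard_avoidBall_highDegree_le {A : Set V} {Δ : ℕ} (hA : Disjoint A (highDegree G Δ))
    (k : ℕ) : (avoidBall G (highDegree G Δ) A k).ncard ≤ A.ncard * (1 + Δ) ^ k := by
  induction k with
  | zero => simp [avoidBall]
  | succ k ih =>
    set X := avoidBall G (highDegree G Δ) A k with hX
    have h₁ : (nbhd G X).ncard ≤ X.ncard * Δ := ncard_nbhd_le fun v hv =>
      (not_le.1 (Set.disjoint_left.1 (disjoint_avoidBall hA k) hv)).le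
    have h₂ : (avoidBall G (highDegree G Δ) A (k + 1)).ncard ≤ X.ncard + (nbhd G X).ncard :=
      (Set.ncard_union_le _ _).trans
        (Nat.add_le_add_left (Set.ncard_le_ncard Set.sdiff_subset) _)
    calc _ ≤ X.ncard * (1 + Δ) := by linarith
      _ ≤ A.ncard * (1 + Δ) ^ k * (1 + Δ) := Nat.mul_le_mul_right _ ih
      _ = _ := by ring

/-- Either a vertex outside `X` lies in a connected set of size `K` avoiding `X`, or it lies in a
connected set of size at most `K` whose neighbourhood is contained in `X`. -/
lemma exists_connected_ncard_eq_or {X : Set V} {v : V} (hv : v ∉ X) {K : ℕ} (hK : 1 ≤ K) :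
    (∃ S : Set V, (G.induce S).Connected ∧ Disjoint S X ∧ v ∈ S ∧ S.ncard = K) ∨
      ∃ S : Set V, v ∈ S ∧ S.ncard ≤ K ∧ nbhd G S ⊆ X := by
  induction K, hK using Nat.le_induction with
  | base => exact Or.inl ⟨{v}, induce_singleton_connected v, by simpa using hv, rfl, by simp⟩
  | succ K _ ih =>
    rcases ih with ⟨S, hS, hSX, hvS, hc⟩ | ⟨S, hvS, hc, hN⟩
    · by_cases hN : nbhd G S ⊆ X
      · exact Or.inr ⟨S, hvS, by omega, hN⟩
      · obtain ⟨y, ⟨hyS, u, hu, huy⟩, hyX⟩ := Set.not_subset.1 hN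
        refine Or.inl ⟨{y} ∪ S, induce_union_connected_of_adj (induce_singleton_connected y) hS
          rfl hu huy.symm, Set.disjoint_union_left.2 ⟨by simpa using hyX, hSX⟩, Or.inr hvS, ?_⟩
        rw [Set.singleton_union, Set.ncard_insert_of_notMem hyS, hc]
    · exact Or.inr ⟨S, hvS, by omega, hN⟩

/-- In a graph where small sets expand, deleting few vertices leaves a connected set of
prescribed small size. -/
lemma exists_connected_ncard_eq {g Λ K s : ℕ}
    (hexp : ∀ S : Set V, S.ncard ≤ Λ → 2 * S.ncard ≤ g * (nbhd G S).ncard)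
    {X : Set V} (hK : 1 ≤ K) (hs : s * K ≤ Λ) (hsX : s + X.ncard ≤ Nat.card V)
    (hX : g * X.ncard < 2 * s) :
    ∃ S : Set V, (G.induce S).Connected ∧ Disjoint S X ∧ S.ncard = K := by
  classical
  by_contra! hno
  have hcl : ∀ v : V, ∃ S : Set V, v ∉ X → v ∈ S ∧ S.ncard ≤ K ∧ nbhd G S ⊆ X := by
    intro v
    by_cases hv : v ∈ X
    · exact ⟨∅, fun h => absurd hv h⟩
    · rcases exists_connected_ncard_eq_or (G := G) hv hK with ⟨S, hS, hSX, -, hc⟩ | ⟨S, hS⟩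
      · exact absurd hc (hno S hS hSX)
      · exact ⟨S, fun _ => hS⟩
  choose S hS using hcl
  obtain ⟨A, hAX, hAs⟩ : ∃ A ⊆ Xᶜ, A.ncard = s := by
    refine Set.exists_subset_card_eq ?_
    have := Set.ncard_add_ncard_compl X
    omega
  set Y := ⋃ v ∈ A.toFinite.toFinset, S v with hY
  have hmemY : ∀ v ∈ A, S v ⊆ Y := fun v hv =>
    Set.subset_biUnion_of_mem (u := S) (by simpa using hv)
  have hAY : s ≤ Y.ncard :=
    hAs ▸ Set.ncard_le_ncard fun v hv => hmemY v hv (hS v (hAX hv)).1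
  have hYΛ : Y.ncard ≤ Λ := by
    refine (Finset.set_ncard_biUnion_le _ _).trans (le_trans ?_ hs)
    rw [← hAs, Set.ncard_eq_toFinset_card A]
    exact Finset.sum_le_card_nsmul _ _ _ fun v hv => (hS v (hAX (by simpa using hv))).2.1
  have hNY : nbhd G Y ⊆ X := by
    rintro w ⟨hwY, u, hu, huw⟩
    obtain ⟨v, hv, huv⟩ := Set.mem_iUnion₂.1 hu
    have hv' : v ∈ A := by simpa using hv
    exact (hS v (hAX hv')).2.2 ⟨fun h => hwY (hmemY v hv' h), u, huv, huw⟩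
  have h₁ := hexp Y hYΛ
  have h₂ := Nat.mul_le_mul_left g (Set.ncard_le_ncard hNY)
  omega

/-- In a graph with few vertices of high degree in which small sets expand, there are many
connected sets of prescribed size that are pairwise far apart once the vertices of high degree
are deleted. -/
lemma exists_far_connected {g Λ K t Δ ρ : ℕ} (hg : 1 ≤ g)
    (hexp : ∀ S : Set V, S.ncard ≤ Λ → 2 * S.ncard ≤ g * (nbhd G S).ncard)
    (hK : 1 ≤ K) (ht : 1 ≤ t) (hT : (highDegree G Δ).ncard ≤ t)
    (hΛ : g * (t + t * (K * (1 + Δ) ^ ρ)) * K ≤ Λ)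
    (hV : g * (t + t * (K * (1 + Δ) ^ ρ)) + (t + t * (K * (1 + Δ) ^ ρ)) ≤ Nat.card V)
    (j : ℕ) (hj : j ≤ t) :
    ∃ S : ℕ → Set V, (∀ i < j, (G.induce (S i)).Connected ∧ Disjoint (S i) (highDegree G Δ) ∧
      (S i).ncard = K) ∧
      ∀ i k, i < k → k < j → Disjoint (avoidBall G (highDegree G Δ) (S i) ρ) (S k) := by
  classical
  induction j with
  | zero => exact ⟨fun _ => ∅, by simp, by simp⟩
  | succ j ih =>
    obtain ⟨S, hS, hfar⟩ := ih (by omega)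
    set Y := ⋃ i ∈ Finset.range j, avoidBall G (highDegree G Δ) (S i) ρ with hY
    set X := highDegree G Δ ∪ Y with hX
    have hYc : Y.ncard ≤ t * (K * (1 + Δ) ^ ρ) := by
      refine (Finset.set_ncard_biUnion_le _ _).trans ((Finset.sum_le_card_nsmul _ _
        (K * (1 + Δ) ^ ρ) fun i hi => ?_).trans ?_)
      · obtain ⟨-, hd, hc⟩ := hS i (Finset.mem_range.1 hi)
        exact hc ▸ ncard_avoidBall_highDegree_le hd ρ
      · simpa using Nat.mul_le_mul_right _ (by omega : j ≤ t)
    have hXc : X.ncard ≤ t + t * (K * (1 + Δ) ^ ρ) :=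
      (Set.ncard_union_le _ _).trans (Nat.add_le_add hT hYc)
    obtain ⟨S₀, hc₀, hd₀, hK₀⟩ := exists_connected_ncard_eq (X := X) hexp hK hΛ
      (by omega) (by
        have h₁ := Nat.mul_le_mul_left g hXc
        have h₂ : 0 < g * (t + t * (K * (1 + Δ) ^ ρ)) := by positivity
        omega)
    refine ⟨Function.update S j S₀, fun i hi => ?_, fun i k hik hk => ?_⟩
    · rcases Nat.lt_succ_iff_lt_or_eq.1 hi with hi | rfl
      · rw [Function.update_of_ne hi.ne]
        exact hS i hi
      · rw [Function.update_self]
        exact ⟨hc₀, hd₀.mono_right Set.subset_union_left, hK₀⟩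
    · have hij : i < j := by omega
      rw [Function.update_of_ne hij.ne]
      rcases Nat.lt_succ_iff_lt_or_eq.1 hk with hk | rfl
      · rw [Function.update_of_ne hk.ne]
        exact hfar i k hik hk
      · rw [Function.update_self]
        refine hd₀.symm.mono_left (subset_trans ?_ Set.subset_union_right)
        exact Set.subset_biUnion_of_mem (u := fun i => avoidBall G (highDegree G Δ) (S i) ρ)
          (Finset.mem_coe.2 (Finset.mem_range.2 hij))

lemma lt_ncard_avoidBall_of_expansion {g s a : ℕ} (hg : 1 ≤ g)
    (hexp : ∀ S : Set V, S.ncard ≤ s → 2 * S.ncard ≤ g * (nbhd G S).ncard)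
    {F A : Set V} (hF : g * F.ncard ≤ A.ncard) (hs : s < 2 ^ a * A.ncard) :
    s < (avoidBall G F A (a * g)).ncard := by
  have hg0 : (0 : ℝ) < g := by exact_mod_cast hg
  have key : (s : ℝ) < (avoidBall G F A (a * g)).ncard := by
    refine lt_ncard_avoidBall (γ := 1 / g) (fun S hS => ?_) (by positivity) ?_ ?_ ?_
    · have h : (2 * S.ncard : ℝ) ≤ g * (nbhd G S).ncard := by
        exact_mod_cast hexp S (by exact_mod_cast hS)
      rw [show 2 * (1 / (g : ℝ)) * S.ncard = 2 * S.ncard / g by ring, div_le_iff₀ hg0]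
      linarith
    · rw [one_div_mul_eq_div, le_div_iff₀ hg0, mul_comm]
      exact_mod_cast hF
    · rw [mul_one_div_cancel hg0.ne']
    · exact_mod_cast hs
  exact_mod_cast key

lemma hasHubs_of_ncard_highDegree_le {t g Δ a b B D Z Λ : ℕ} (hg : 1 ≤ g) (ht : 1 ≤ t)
    (hexp : ∀ S : Set V, S.ncard ≤ Λ → 2 * S.ncard ≤ g * (nbhd G S).ncard)
    (hT : (highDegree G Δ).ncard ≤ t)
    (hD : D < 2 ^ a * (g * t)) (hDΛ : D ≤ Λ) (hBD : g * (B + t) ≤ D)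
    (hZ : Z < 2 ^ b * D) (hZΛ : Z ≤ Λ)
    (hΛ : g * (t + t * (g * t * (1 + Δ) ^ (2 * (a * g) + b * g))) * (g * t) ≤ Λ)
    (hV : g * (t + t * (g * t * (1 + Δ) ^ (2 * (a * g) + b * g))) +
      (t + t * (g * t * (1 + Δ) ^ (2 * (a * g) + b * g))) ≤ Nat.card V) :
    HasHubs G t (g * t + a * g) B (b * g) Z (t * (g * t * (1 + Δ) ^ (a * g))) := by
  classical
  set T := highDegree G Δ with hTdef
  have hK : 1 ≤ g * t := Nat.mul_pos hg ht
  obtain ⟨S, hS, hfar⟩ := exists_far_connected hg hexp hK ht hT hΛ hV t le_rfl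
  set r := a * g with hr
  set R := b * g with hR
  have hfar' : ∀ i < t, ∀ k < t, i ≠ k → Disjoint (avoidBall G T (S i) (r + R))
      (avoidBall G T (S k) r) := by
    intro i hi k hk hik
    rcases lt_or_gt_of_ne hik with h | h
    · refine disjoint_avoidBall_avoidBall (hS k hk).2.1 ?_
      exact (hfar i k h hk).mono_left (avoidBall_mono_radius (by omega))
    · refine (disjoint_avoidBall_avoidBall (hS i hi).2.1 ?_).symm
      exact (hfar k i h hi).mono_left (avoidBall_mono_radius (by omega))
  have hne : ∀ i : Fin t, ∃ v, v ∈ S i := fun i =>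
    Set.nonempty_of_ncard_ne_zero (by rw [(hS i i.2).2.2]; omega)
  choose c hc using hne
  refine ⟨fun i => avoidBall G T (S i) r, c, ?_, fun i => subset_avoidBall _ _ _ (hc i),
    ?_, ?_, ?_⟩
  · intro i k hik
    exact (hfar' i i.2 k k.2 (fun h => hik (Fin.ext h))).mono_left
      (avoidBall_mono_radius (by omega))
  · intro i u hu
    obtain ⟨hSc, -, hcard⟩ := hS i i.2
    by_cases huS : u ∈ S i
    · exact ⟨S i, subset_avoidBall _ _ _, hSc, hc i, huS, by omega⟩
    · obtain ⟨P, hP, huP, -, -, hPb, hPc, w, hw, x, hx, hwx⟩ :=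
        exists_connected_of_mem_avoidBall hu huS
      exact ⟨S i ∪ P, Set.union_subset (subset_avoidBall _ _ _) hPb,
        induce_union_connected_of_adj hSc hP hw hx hwx, Or.inl (hc i), Or.inr huP,
        (Set.ncard_union_le _ _).trans (by omega)⟩
  · intro i F hF
    obtain ⟨-, -, hcard⟩ := hS i i.2
    have hUD : D < (avoidBall G T (S i) r).ncard := by
      refine lt_ncard_avoidBall_of_expansion hg (fun S hS => hexp S (hS.trans hDΛ)) ?_ ?_
      · rw [hcard]
        exact Nat.mul_le_mul_left g hT
      · rwa [hcard]
    have hFT : (F ∪ T).ncard ≤ B + t :=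
      (Set.ncard_union_le _ _).trans (Nat.add_le_add hF hT)
    have hZlt : Z < (avoidBall G (F ∪ T) (avoidBall G T (S i) r) R).ncard := by
      refine lt_ncard_avoidBall_of_expansion hg (fun S hS => hexp S (hS.trans hZΛ)) ?_ ?_
      · exact ((Nat.mul_le_mul_left g hFT).trans hBD).trans hUD.le
      · exact hZ.trans_le (Nat.mul_le_mul_left _ hUD.le)
    refine hZlt.le.trans (Set.ncard_le_ncard ?_)
    refine avoidBall_subset_avoidBall
      (F₂ := ⋃ k ∈ {k | k ≠ i}, avoidBall G T (S (k : Fin t)) r) ?_ ?_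
    · exact Set.union_subset_union_left _ Set.subset_union_left
    · refine Set.disjoint_iUnion₂_right.2 fun k hk => ?_
      refine (hfar' i i.2 k k.2 fun h => hk (Fin.ext h.symm)).mono_left ?_
      rw [← avoidBall_add]
      exact avoidBall_anti Set.subset_union_right _ _
  · have h := (Finset.univ : Finset (Fin t)).set_ncard_biUnion_le
      (fun i : Fin t => avoidBall G T (S i) r)
    simp only [Finset.mem_univ, Set.iUnion_true] at h
    refine h.trans ((Finset.sum_le_card_nsmul _ _ (g * t * (1 + Δ) ^ r) fun i _ => ?_).trans
      (by simp))
    obtain ⟨-, hd, hcard⟩ := hS i i.2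
    exact hcard ▸ ncard_avoidBall_highDegree_le hd r

end HubConstruction

section Asymptotics

lemma exists_hubs {V : Type*} [Finite V] {G : SimpleGraph V} {t p B : ℕ} (ht : 3 ≤ t)
    (htp : t ≤ p) (hp : 32 ≤ p) (hpow : 1000 * p ^ 20 ≤ 2 ^ p) (hB : B ≤ 2 ^ (2 * p))
    (hexp : ∀ S : Set V, S.ncard ≤ 2 ^ p ^ 13 → 2 * S.ncard ≤ p ^ 3 * (nbhd G S).ncard)
    (hV : 2 ^ p ^ 13 ≤ Nat.card V) :
    ∃ Z u, HasHubs G t (p ^ 3 * t + 5 * p * p ^ 3) B (p ^ 7 * p ^ 3) Z u ∧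
      (B + u) * 2 ^ (2 * p) ≤ Z := by
  have hp1 : 1 ≤ p := by omega
  have hmono : ∀ {i j : ℕ}, i ≤ j → p ^ i ≤ p ^ j := fun h => Nat.pow_le_pow_right hp1 h
  have h32 : ∀ i, 32 * p ^ i ≤ p ^ (i + 1) := fun i => by
    rw [pow_succ, mul_comm]
    exact Nat.mul_le_mul_left _ hp
  have hpoly : ∀ i ≤ 20, 1000 * p ^ i ≤ 2 ^ p := fun i hi =>
    (Nat.mul_le_mul_left _ (hmono hi)).trans hpow
  have hp2p : p ≤ 2 ^ p := Nat.lt_two_pow_self.le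
  have hp_le : 2 ^ p ≤ 2 ^ (2 * p) := Nat.pow_le_pow_right (by norm_num) (by omega)
  have hBt : B + t ≤ 2 ^ (2 * p + 1) := by rw [pow_succ]; omega
  rcases le_total t (highDegree G (2 ^ (5 * p))).ncard with hT | hT
  · refine ⟨2 ^ (4 * p + 2), t, hasHubs_of_le_ncard_highDegree hT ?_ ?_ ?_, ?_⟩
    · have h₁ : 2 ^ (2 * p + 1) ≤ 2 ^ (4 * p + 2) :=
        Nat.pow_le_pow_right (by norm_num) (by omega)
      have h₂ : 2 ^ (4 * p + 2 + 1) ≤ 2 ^ (5 * p) :=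
        Nat.pow_le_pow_right (by norm_num) (by omega)
      rw [pow_succ] at h₂
      omega
    · rw [← pow_add]
      exact Nat.one_le_pow _ _ hp1
    · have : 0 < p ^ 3 * t := by positivity
      omega
    · calc (B + t) * 2 ^ (2 * p) ≤ 2 ^ (2 * p + 1) * 2 ^ (2 * p) := Nat.mul_le_mul_right _ hBt
        _ = 2 ^ (2 * p + 1 + 2 * p) := (pow_add _ _ _).symm
        _ ≤ 2 ^ (4 * p + 2) := Nat.pow_le_pow_right (by norm_num) (by omega)
  · have hΔ : ∀ e, (1 + 2 ^ (5 * p)) ^ e ≤ 2 ^ (6 * p * e) := by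
      intro e
      rw [pow_mul 2 (6 * p) e]
      refine Nat.pow_le_pow_left ?_ e
      have h₁ : 2 ^ (5 * p + 1) ≤ 2 ^ (6 * p) := Nat.pow_le_pow_right (by norm_num) (by omega)
      have h₂ : 1 ≤ 2 ^ (5 * p) := Nat.one_le_two_pow
      rw [pow_succ] at h₁
      omega
    have e₁ : 6 * p * (2 * (5 * p * p ^ 3) + p ^ 7 * p ^ 3) = 60 * p ^ 5 + 6 * p ^ 11 := by ring
    have e₂ : 6 * p * (5 * p * p ^ 3) = 30 * p ^ 5 := by ring
    have hY : (1 + 2 ^ (5 * p)) ^ (2 * (5 * p * p ^ 3) + p ^ 7 * p ^ 3) ≤ 2 ^ p ^ 12 := by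
      refine (hΔ _).trans (Nat.pow_le_pow_right (by norm_num) ?_)
      rw [e₁]
      have : 32 * p ^ 11 ≤ p ^ 12 := h32 11
      have : 32 * p ^ 5 ≤ p ^ 6 := h32 5
      have := hmono (show 6 ≤ 11 by norm_num)
      omega
    have hU : (1 + 2 ^ (5 * p)) ^ (5 * p * p ^ 3) ≤ 2 ^ (30 * p ^ 5) := e₂ ▸ hΔ _
    have hX : t + t * (p ^ 3 * t * (1 + 2 ^ (5 * p)) ^ (2 * (5 * p * p ^ 3) + p ^ 7 * p ^ 3)) ≤
        2 * p ^ 5 * 2 ^ p ^ 12 := by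
      have h₁ : t * (p ^ 3 * t *
          (1 + 2 ^ (5 * p)) ^ (2 * (5 * p * p ^ 3) + p ^ 7 * p ^ 3)) ≤
          p * (p ^ 3 * p * 2 ^ p ^ 12) := by gcongr
      have h₂ : p ≤ p ^ 5 := by simpa using hmono (show 1 ≤ 5 by norm_num)
      have h₃ : 1 ≤ 2 ^ p ^ 12 := Nat.one_le_two_pow
      nlinarith
    have hsum : p + p ^ 12 ≤ p ^ 13 := by
      have : 32 * p ^ 12 ≤ p ^ 13 := h32 12
      have : p ≤ p ^ 12 := by simpa using hmono (show 1 ≤ 12 by norm_num)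
      omega
    have hΛ : 2 ^ p * 2 ^ p ^ 12 ≤ 2 ^ p ^ 13 := by
      rw [← pow_add]
      exact Nat.pow_le_pow_right (by norm_num) hsum
    refine ⟨2 ^ p ^ 7, _, hasHubs_of_ncard_highDegree_le (g := p ^ 3) (D := 2 ^ (5 * p))
      (Λ := 2 ^ p ^ 13) (Nat.one_le_pow _ _ hp1) (by omega) hexp hT ?_ ?_ ?_ ?_ ?_ ?_ ?_, ?_⟩
    · have h₁ : 1 ≤ p ^ 3 := Nat.one_le_pow _ _ hp1
      have h₂ : 1 < p ^ 3 * t := by nlinarith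
      exact lt_mul_of_one_lt_right (by positivity) h₂
    · refine Nat.pow_le_pow_right (by norm_num) ?_
      have : 32 * p ≤ p ^ 2 := by simpa using h32 1
      have := hmono (show 2 ≤ 13 by norm_num)
      omega
    · calc p ^ 3 * (B + t) ≤ 2 ^ p * 2 ^ (2 * p + 1) :=
            Nat.mul_le_mul (by have := hpoly 3 (by norm_num); omega) hBt
        _ = 2 ^ (p + (2 * p + 1)) := (pow_add _ _ _).symm
        _ ≤ 2 ^ (5 * p) := Nat.pow_le_pow_right (by norm_num) (by omega)
    · have h₁ : 1 < 2 ^ (5 * p) := Nat.one_lt_two_pow (by omega)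
      have h₂ : 0 < 2 ^ p ^ 7 := by positivity
      nlinarith
    · exact Nat.pow_le_pow_right (by norm_num) (hmono (by norm_num))
    · refine le_trans ?_ hΛ
      calc _ ≤ p ^ 3 * (2 * p ^ 5 * 2 ^ p ^ 12) * (p ^ 3 * p) := by gcongr
        _ = 2 * p ^ 12 * 2 ^ p ^ 12 := by ring
        _ ≤ 2 ^ p * 2 ^ p ^ 12 := by
          gcongr
          have := hpoly 12 (by norm_num)
          omega
    · refine le_trans ?_ (hΛ.trans hV)
      calc _ ≤ p ^ 3 * (2 * p ^ 5 * 2 ^ p ^ 12) + 2 * p ^ 5 * 2 ^ p ^ 12 :=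
            Nat.add_le_add (Nat.mul_le_mul_left _ hX) hX
        _ = (2 * p ^ 8 + 2 * p ^ 5) * 2 ^ p ^ 12 := by ring
        _ ≤ 2 ^ p * 2 ^ p ^ 12 := Nat.mul_le_mul_right _ (by
          have := hpoly 8 (by norm_num)
          have := hpoly 5 (by norm_num)
          omega)
    · have h₁ : t * (p ^ 3 * t * (1 + 2 ^ (5 * p)) ^ (5 * p * p ^ 3)) ≤
          2 ^ p * 2 ^ (30 * p ^ 5) :=
        calc _ ≤ p * (p ^ 3 * p * 2 ^ (30 * p ^ 5)) :=
            Nat.mul_le_mul htp (Nat.mul_le_mul (Nat.mul_le_mul_left _ htp) hU)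
          _ = p ^ 5 * 2 ^ (30 * p ^ 5) := by ring
          _ ≤ 2 ^ p * 2 ^ (30 * p ^ 5) := Nat.mul_le_mul_right _ (by
            have := hpoly 5 (by norm_num)
            omega)
      have h₂ : B + t * (p ^ 3 * t * (1 + 2 ^ (5 * p)) ^ (5 * p * p ^ 3)) ≤
          2 ^ (2 * p) * 2 ^ (30 * p ^ 5) * 2 := by
        have h₃ : 1 ≤ 2 ^ (30 * p ^ 5) := Nat.one_le_two_pow
        nlinarith
      calc _ ≤ 2 ^ (2 * p) * 2 ^ (30 * p ^ 5) * 2 * 2 ^ (2 * p) := Nat.mul_le_mul_right _ h₂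
        _ = 2 ^ (4 * p + 30 * p ^ 5 + 1) := by ring
        _ ≤ 2 ^ p ^ 7 := by
          refine Nat.pow_le_pow_right (by norm_num) ?_
          have : 32 * p ^ 5 ≤ p ^ 6 := h32 5
          have : 32 * p ^ 6 ≤ p ^ 7 := h32 6
          have : p ≤ p ^ 5 := by simpa using hmono (show 1 ≤ 5 by norm_num)
          omega

lemma exists_forall_poly_le_two_pow (δ : ℝ) (t : ℕ) :
    ∃ p₀ : ℕ, ∀ p ≥ p₀, t ≤ p ∧ 8 / δ ≤ p ∧ 1000 * p ^ 20 ≤ 2 ^ p := by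
  have h := (tendsto_pow_const_div_const_pow_of_one_lt 20 (r := (2 : ℝ)) (by norm_num)).eventually
    (ge_mem_nhds (show (0 : ℝ) < 1 / 1000 by norm_num))
  have h' := (tendsto_natCast_atTop_atTop (R := ℝ)).eventually_ge_atTop (8 / δ)
  obtain ⟨p₀, hp₀⟩ := Filter.eventually_atTop.1 ((h.and h').and (Filter.eventually_ge_atTop t))
  refine ⟨p₀, fun p hp => ?_⟩
  obtain ⟨⟨h₁, h₂⟩, h₃⟩ := hp₀ p hp
  refine ⟨h₃, h₂, ?_⟩
  rw [div_le_iff₀ (by positivity)] at h₁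
  have : (1000 : ℝ) * p ^ 20 ≤ 2 ^ p := by linarith
  exact_mod_cast this

end Asymptotics

set_option maxHeartbeats 1000000 in
/-- Lemma 4.3: a sufficiently large `(δ,n)`-expander on `m` vertices with
`2^{log n/(log log n)²} ≤ m ≤ n` contains a `K_t`-minor of order `O((t²/δ)·log n·log log n)`. -/
theorem stmt_10 :
    ∃ C : ℝ, 0 < C ∧
      ∀ δ : ℝ, 0 < δ → δ < 1 / 4 → ∀ t : ℕ, 3 ≤ t → ∃ m₀ : ℕ,
        ∀ n m : ℕ, m₀ ≤ m →
          (2 : ℝ) ^ (logb 2 n / (logb 2 (logb 2 n)) ^ 2) ≤ (m : ℝ) → m ≤ n →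
            ∀ G : SimpleGraph (Fin m), IsDeltaNExpander G δ n →
              HasKtMinorOfOrder G t
                (C * (t ^ 2 / δ) * logb 2 n * logb 2 (logb 2 n)) := by
  refine ⟨20, by norm_num, fun δ hδ hδ4 t ht => ?_⟩
  obtain ⟨p₀, hp₀⟩ := exists_forall_poly_le_two_pow δ t
  refine ⟨2 ^ 2 ^ p₀, fun n m hm hmlow hmn G hG => ?_⟩
  set L := logb 2 n with hL
  set ℓ := logb 2 L with hℓ
  set Lm := logb 2 m with hLm
  have hm1 : 1 ≤ m := le_trans Nat.one_le_two_pow hm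
  have hm0 : (0 : ℝ) < m := by exact_mod_cast hm1
  have hLmL : Lm ≤ L := Real.logb_le_logb_of_le (by norm_num) hm0 (by exact_mod_cast hmn)
  have hLm₀ : (2 : ℝ) ^ p₀ ≤ Lm := by
    rw [hLm, Real.le_logb_iff_rpow_le (by norm_num) hm0]
    exact_mod_cast hm
  have hL0 : 0 < L := lt_of_lt_of_le (by positivity) (hLm₀.trans hLmL)
  have hℓ₀ : (p₀ : ℝ) ≤ ℓ := by
    rw [hℓ, Real.le_logb_iff_rpow_le (by norm_num) hL0]
    exact_mod_cast hLm₀.trans hLmL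
  set p := ⌈ℓ⌉₊ with hpdef
  have hℓp : ℓ ≤ p := Nat.le_ceil ℓ
  obtain ⟨htp, h8p, hpow⟩ := hp₀ p (by exact_mod_cast hℓ₀.trans hℓp)
  have h8 : 8 ≤ δ * p := by rw [div_le_iff₀ hδ] at h8p; linarith
  have hp32R : (32 : ℝ) < p := by nlinarith
  have hp32 : 32 ≤ p := by exact_mod_cast hp32R.le
  have hpℓ : (p : ℝ) < ℓ + 1 := Nat.ceil_lt_add_one ((Nat.cast_nonneg p₀).trans hℓ₀)
  have hℓ31 : 31 < ℓ := by linarith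
  have hLup : L ≤ 2 ^ p := by
    rw [hℓ, Real.logb_le_iff_le_rpow (by norm_num) hL0] at hℓp
    exact_mod_cast hℓp
  have hLlow : (2 : ℝ) ^ p ≤ 2 * L := by
    have h : (p : ℝ) - 1 ≤ logb 2 L := by linarith
    rw [Real.le_logb_iff_rpow_le (by norm_num) hL0, Real.rpow_sub (by norm_num),
      Real.rpow_natCast, Real.rpow_one] at h
    linarith
  have hpowR : (1000 : ℝ) * p ^ 20 ≤ 2 ^ p := by exact_mod_cast hpow
  have hLmℓ : L ≤ Lm * ℓ ^ 2 := by
    rw [← Real.le_logb_iff_rpow_le (by norm_num) hm0, div_le_iff₀ (by positivity)] at hmlow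
    exact hmlow
  have hLmp : L ≤ Lm * p ^ 2 := hLmℓ.trans (by
    have : 0 ≤ Lm := le_trans (by positivity) hLm₀
    gcongr)
  have hLm13 : 2 * (p : ℝ) ^ 13 ≤ Lm := by
    have hp2 : (0 : ℝ) < p ^ 2 := by positivity
    refine le_of_mul_le_mul_right ?_ hp2
    have : (p : ℝ) ^ 15 ≤ p ^ 20 := pow_le_pow_right₀ (by linarith) (by norm_num)
    nlinarith
  have hLm2 : 1 ≤ Lm / 2 := by
    have : (1 : ℝ) ≤ p ^ 13 := one_le_pow₀ (by linarith)
    linarith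
  obtain ⟨D, hD, hD'⟩ := exists_nat_pow_near hLm2 (show (1 : ℝ) < 2 by norm_num)
  rw [pow_succ] at hD'
  have hcard : Nat.card (Fin m) = m := Nat.card_fin m
  set N₀ := ⌈3 * L / δ⌉₊ with hN₀
  have hLδ : L ≤ L / δ := by rw [le_div_iff₀ hδ]; nlinarith
  have hL1 : 1 ≤ L := by linarith
  have hN₀ub : (N₀ : ℝ) ≤ 4 * (L / δ) := by
    have := Nat.ceil_lt_add_one (show 0 ≤ 3 * L / δ by positivity)
    rw [mul_div_assoc] at this
    rw [hN₀, mul_div_assoc]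
    linarith
  have hDℓ : (4 + D : ℝ) ≤ 2 * ℓ := by
    have h : (D : ℝ) ≤ ℓ := by
      rw [hℓ, Real.le_logb_iff_rpow_le (by norm_num) hL0, Real.rpow_natCast]
      linarith
    linarith
  have hM : (((4 + D) * N₀ : ℕ) : ℝ) ≤ 8 * (L * ℓ / δ) := by
    push_cast
    calc (4 + D : ℝ) * N₀ ≤ 2 * ℓ * (4 * (L / δ)) := by gcongr
      _ = _ := by ring
  set B := t ^ 2 * (2 * (p ^ 7 * p ^ 3 + (4 + D) * N₀)) with hB
  have hpR1 : (1 : ℝ) ≤ p := by linarith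
  have hBub : B ≤ 2 ^ (2 * p) := by
    have hLδp : L * ℓ / δ ≤ 2 ^ p * p ^ 2 := by
      rw [div_le_iff₀ hδ]
      calc L * ℓ ≤ 2 ^ p * p := by gcongr
        _ ≤ 2 ^ p * p * (δ * p) := le_mul_of_one_le_right (by positivity) (by linarith)
        _ = 2 ^ p * p ^ 2 * δ := by ring
    have htR : (t : ℝ) ≤ p := by exact_mod_cast htp
    have h₁ : (B : ℝ) ≤ p ^ 2 * (2 * (p ^ 7 * p ^ 3 + 8 * (2 ^ p * p ^ 2))) := by
      rw [hB]
      push_cast at hM ⊢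
      have hM' : (4 + D : ℝ) * N₀ ≤ 8 * (2 ^ p * p ^ 2) := by linarith
      exact mul_le_mul (pow_le_pow_left₀ (Nat.cast_nonneg t) htR 2) (by linarith)
        (by positivity) (by positivity)
    have h₂ : (p : ℝ) ^ 12 ≤ p ^ 20 := pow_le_pow_right₀ hpR1 (by norm_num)
    have h₃ : (p : ℝ) ^ 4 ≤ p ^ 20 := pow_le_pow_right₀ hpR1 (by norm_num)
    have h₄ : (1 : ℝ) ≤ p ^ 20 := one_le_pow₀ hpR1
    have h₅ : (B : ℝ) ≤ 2 ^ (2 * p) := by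
      calc (B : ℝ) ≤ 2 * p ^ 12 + 16 * p ^ 4 * 2 ^ p := by linarith
        _ ≤ 2 ^ p * 2 ^ p := by nlinarith
        _ = 2 ^ (2 * p) := by ring
    exact_mod_cast h₅
  have hmΛ : (2 : ℝ) ^ p ^ 13 * 2 ^ (2 ^ D : ℕ) ≤ m := by
    rw [← pow_add, ← Real.rpow_natCast, ← Real.le_logb_iff_rpow_le (by norm_num) hm0]
    push_cast
    linarith
  have hΛm : 2 ^ p ^ 13 ≤ Nat.card (Fin m) := by
    rw [hcard]
    have : (1 : ℝ) ≤ 2 ^ (2 ^ D : ℕ) := one_le_pow₀ (by norm_num)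
    have : (2 : ℝ) ^ p ^ 13 ≤ m := le_trans (le_mul_of_one_le_right (by positivity) this) hmΛ
    exact_mod_cast this
  have hexp : ∀ S : Set (Fin m), S.ncard ≤ 2 ^ p ^ 13 →
      2 * S.ncard ≤ p ^ 3 * (nbhd G S).ncard := by
    intro S hS
    have h₁ := hG.le_ncard_nbhd (d := D) (S := S) (by rwa [hcard]) (by
      rw [hcard, le_div_iff₀ (by positivity)]
      refine le_trans ?_ hmΛ
      exact mul_le_mul_of_nonneg_right (by exact_mod_cast hS) (by positivity))
    have h₂ : 2 ≤ (p : ℝ) ^ 3 * (δ * 2 ^ D / L) := by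
      rw [← mul_div_assoc, le_div_iff₀ hL0]
      have h₃ : L ≤ 4 * 2 ^ D * p ^ 2 := hLmp.trans (by gcongr; linarith)
      have h₄ : (0 : ℝ) ≤ 2 ^ D * p ^ 2 := by positivity
      have h₅ := mul_le_mul_of_nonneg_right h8 h₄
      calc 2 * L ≤ 8 * (2 ^ D * p ^ 2) := by linarith
        _ ≤ δ * p * (2 ^ D * p ^ 2) := h₅
        _ = _ := by ring
    have h₆ : (2 * S.ncard : ℝ) ≤ p ^ 3 * (nbhd G S).ncard :=
      calc (2 * S.ncard : ℝ) ≤ p ^ 3 * (δ * 2 ^ D / L) * S.ncard := by gcongr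
        _ = p ^ 3 * (δ * 2 ^ D / L * S.ncard) := by ring
        _ ≤ _ := by gcongr
    exact_mod_cast h₆
  obtain ⟨Z, u, ⟨U, c, hU, hc, hW, hgrow, hu⟩, hZ⟩ :=
    exists_hubs ht htp hp32 hpow hBub hexp hΛm
  have hminor := hG.hasKtMinorOfOrder_of_hubs (D := D) (N₀ := N₀) hδ (by linarith)
    (by rwa [hcard]) (by rw [hcard]; linarith) (by rwa [hcard]) (Nat.le_ceil _) U c hU hc hW
    hgrow (by
      have h₁ : ((B + u : ℕ) : ℝ) * 2 ^ (2 * p) ≤ Z := by exact_mod_cast hZ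
      have h₂ : ((B + (⋃ k, U k).ncard : ℕ) : ℝ) ≤ (B + u : ℕ) := by
        exact_mod_cast Nat.add_le_add_left hu B
      have h₃ : 1 ≤ δ / (2 * L) * 2 ^ (2 * p) := by
        rw [div_mul_eq_mul_div, le_div_iff₀ (by positivity)]
        have h₄ : (p : ℝ) ≤ 2 ^ p := by exact_mod_cast Nat.lt_two_pow_self.le
        have h₅ : δ * p ≤ δ * 2 ^ p := by gcongr
        calc 1 * (2 * L) ≤ 8 * 2 ^ p := by linarith
          _ ≤ δ * 2 ^ p * 2 ^ p := by gcongr; linarith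
          _ = δ * 2 ^ (2 * p) := by ring
      refine h₂.trans ?_
      calc ((B + u : ℕ) : ℝ) ≤ (B + u : ℕ) * (δ / (2 * L) * 2 ^ (2 * p)) :=
            le_mul_of_one_le_right (Nat.cast_nonneg _) h₃
        _ = δ / (2 * L) * ((B + u : ℕ) * 2 ^ (2 * p)) := by ring
        _ ≤ _ := by gcongr)
  obtain ⟨P, h₁, h₂, h₃, h₄, h₅⟩ := hminor
  refine ⟨P, h₁, h₂, h₃, h₄, h₅.trans ?_⟩
  have htR : (t : ℝ) ≤ p := by exact_mod_cast htp
  have ht1 : (1 : ℝ) ≤ t := by exact_mod_cast (by omega : 1 ≤ t)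
  have hX : L ≤ L * ℓ / δ := by
    rw [le_div_iff₀ hδ]
    nlinarith
  have hκ : 2 * ((p : ℝ) ^ 3 * t + 5 * p * p ^ 3) + 2 * (p ^ 7 * p ^ 3) + 1 ≤ L := by
    have e₁ : (p : ℝ) ^ 4 ≤ p ^ 20 := pow_le_pow_right₀ hpR1 (by norm_num)
    have e₂ : (p : ℝ) ^ 10 ≤ p ^ 20 := pow_le_pow_right₀ hpR1 (by norm_num)
    have e₃ : (1 : ℝ) ≤ p ^ 20 := one_le_pow₀ hpR1
    have e₄ : (p : ℝ) ^ 3 * t ≤ p ^ 3 * p := by gcongr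
    linarith
  have htt : (t : ℝ) ≤ t ^ 2 := by nlinarith
  push_cast at hM ⊢
  calc _ ≤ (t : ℝ) ^ 2 * (2 * ((p : ℝ) ^ 3 * t + 5 * p * p ^ 3) + 2 * (p ^ 7 * p ^ 3) + 1 +
        2 * ((4 + D) * N₀)) := by linarith
    _ ≤ t ^ 2 * (20 * (L * ℓ / δ)) := by
      gcongr
      linarith
    _ = _ := by ring
end
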